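/- Let δ ∈ [1,2). Suppose μ(g² log g²)^δ ≤ C μ(|∇g|²) for all g ∈ C¹_b(ℝⁿ) with μ(g²) = 1. Then for every probability measure ν on ℝⁿ: W₂(ν,μ)² ≤ (C^{2/δ} / (2−δ)²) · I(ν|μ)^{(2−δ)/δ}. -/

import Mathlib

open MeasureTheory ENNReal NNReal Classical

/-- A coupling of `ν` and `μ`. -/
def IsCoupling {n : ℕ}
    (π : Measure (EuclideanSpace ℝ (Fin n) × EuclideanSpace ℝ (Fin n)))
    (ν μ : Measure (EuclideanSpace ℝ (Fin n))) : Prop :=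
  π.map Prod.fst = ν ∧ π.map Prod.snd = μ

/-- The `L^p`-Wasserstein distance for the Euclidean distance. -/
noncomputable def wassersteinDist {n : ℕ} (p : ℝ)
    (ν μ : Measure (EuclideanSpace ℝ (Fin n))) : ℝ≥0∞ :=
  (⨅ (π : Measure (EuclideanSpace ℝ (Fin n) × EuclideanSpace ℝ (Fin n)))
      (_ : IsCoupling π ν μ), ∫⁻ q, edist q.1 q.2 ^ p ∂π) ^ (1 / p)

/-- The relative entropy (Kullback information) `H(ν|μ)`. -/
noncomputable def relEntropy {n : ℕ}
    (ν μ : Measure (EuclideanSpace ℝ (Fin n))) : ℝ≥0∞ :=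
  if ν ≪ μ ∧ Integrable (llr ν μ) ν then ENNReal.ofReal (∫ x, llr ν μ x ∂ν) else ⊤

/-- The Fisher information `I(ν|μ) = ∫ |∇√f|² dμ` for `ν = fμ` with `√f ∈ H¹(μ)`,
and `+∞` otherwise. -/
noncomputable def fisherInfo {n : ℕ}
    (ν μ : Measure (EuclideanSpace ℝ (Fin n))) : ℝ≥0∞ :=
  ⨅ (f : EuclideanSpace ℝ (Fin n) → ℝ) (_ : ∀ x, 0 ≤ f x)
    (_ : ν = μ.withDensity fun x => ENNReal.ofReal (f x))
    (_ : Differentiable ℝ fun x => Real.sqrt (f x)),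
    ∫⁻ x, (‖gradient (fun y => Real.sqrt (f y)) x‖₊ : ℝ≥0∞) ^ 2 ∂μ

section Duality

open BoundedContinuousFunction CompactlySupported Filter Topology

theorem ext_of_forall_lintegral_le {X : Type*} [TopologicalSpace X] [MeasurableSpace X]
    [HasOuterApproxClosed X] [BorelSpace X] {P Q : Measure X} [IsProbabilityMeasure P]
    [IsProbabilityMeasure Q] (h : ∀ f : X →ᵇ ℝ≥0, ∫⁻ x, f x ∂P ≤ ∫⁻ x, f x ∂Q) : P = Q := by
  refine ext_of_forall_lintegral_eq_of_IsFiniteMeasure fun f => le_antisymm (h f) ?_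
  set M : ℝ≥0 := nndist f 0
  have hM : ∀ x, f x ≤ M := NNReal.upper_bound f
  let g : X →ᵇ ℝ≥0 := BoundedContinuousFunction.const X M - f
  have hg : ∀ x, (f x : ℝ≥0∞) + g x = M := fun x => by
    have : f x + (M - f x) = M := add_tsub_cancel_of_le (hM x)
    simp only [g, BoundedContinuousFunction.coe_sub, Pi.sub_apply,
      BoundedContinuousFunction.const_apply]
    exact_mod_cast this
  have key : ∀ ρ : Measure X, IsProbabilityMeasure ρ →
      ∫⁻ x, f x ∂ρ + ∫⁻ x, g x ∂ρ = M := fun ρ _ => by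
    rw [← lintegral_add_left (by fun_prop)]
    simp [hg]
  have hP := key P inferInstance
  have hQ := key Q inferInstance
  have hgQ : ∫⁻ x, g x ∂Q ≠ ⊤ := fun h => by simp [h] at hQ
  have : ∫⁻ x, f x ∂Q + ∫⁻ x, g x ∂Q ≤ ∫⁻ x, f x ∂P + ∫⁻ x, g x ∂Q := by
    rw [hQ, ← hP]
    exact add_le_add le_rfl (h g)
  exact (ENNReal.add_le_add_iff_right hgQ).1 this

/-- The values of `∫ φ dν + ∫ ψ dμ + s D` over the triples with `φ ⊕ ψ + s c ≥ h`. -/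
def dualValues {X : Type*} [TopologicalSpace X] [MeasurableSpace X] (ν μ : Measure X)
    (c : X × X → ℝ) (D : ℝ) (h : X × X → ℝ) : Set ℝ :=
  {r | ∃ (φ ψ : X →ᵇ ℝ) (s : ℝ), 0 ≤ s ∧ (∀ x y, h (x, y) ≤ φ x + ψ y + s * c (x, y)) ∧
    r = ∫ x, φ x ∂ν + ∫ y, ψ y ∂μ + s * D}

section dualValues

variable {X : Type*} [TopologicalSpace X] [MeasurableSpace X] {ν μ : Measure X}
  {c : X × X → ℝ} {D : ℝ}

theorem dualValues_smul {h : X × X → ℝ} {a r : ℝ} (ha : 0 ≤ a) (hr : r ∈ dualValues ν μ c D h) :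
    a * r ∈ dualValues ν μ c D (a • h) := by
  obtain ⟨φ, ψ, s, hs, hle, rfl⟩ := hr
  refine ⟨a • φ, a • ψ, a * s, by positivity, fun x y => ?_, ?_⟩
  · have := mul_le_mul_of_nonneg_left (hle x y) ha
    simp only [Pi.smul_apply, smul_eq_mul, BoundedContinuousFunction.coe_smul]
    linarith
  · simp only [BoundedContinuousFunction.coe_smul, smul_eq_mul, integral_const_mul]
    ring

theorem dualValues_add [OpensMeasurableSpace X] [IsFiniteMeasure ν] [IsFiniteMeasure μ]
    {h k : X × X → ℝ} {r t : ℝ}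
    (hr : r ∈ dualValues ν μ c D h) (ht : t ∈ dualValues ν μ c D k) :
    r + t ∈ dualValues ν μ c D (h + k) := by
  obtain ⟨φ, ψ, s, hs, hle, rfl⟩ := hr
  obtain ⟨φ', ψ', s', hs', hle', rfl⟩ := ht
  refine ⟨φ + φ', ψ + ψ', s + s', by positivity, fun x y => ?_, ?_⟩
  · have := hle x y
    have := hle' x y
    simp only [Pi.add_apply, BoundedContinuousFunction.coe_add]
    linarith
  · simp only [BoundedContinuousFunction.coe_add, Pi.add_apply]
    rw [integral_add (φ.integrable _) (φ'.integrable _),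
      integral_add (ψ.integrable _) (ψ'.integrable _)]
    ring

theorem le_of_mem_dualValues [OpensMeasurableSpace X] [IsProbabilityMeasure ν]
    [IsProbabilityMeasure μ]
    (hD : ∀ φ ψ : X →ᵇ ℝ, (∀ x y, φ x + ψ y ≤ c (x, y)) → ∫ x, φ x ∂ν + ∫ y, ψ y ∂μ ≤ D)
    {h : X × X → ℝ} {m r : ℝ} (hm : ∀ q, m ≤ h q) (hr : r ∈ dualValues ν μ c D h) : m ≤ r := by
  obtain ⟨φ, ψ, s, hs, hle, rfl⟩ := hr
  rcases hs.eq_or_lt with rfl | hs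
  · obtain ⟨x₀⟩ : Nonempty X := nonempty_of_isProbabilityMeasure ν
    have h1 : ∀ y, m - ∫ x, φ x ∂ν ≤ ψ y := fun y => by
      have : ∫ _x, (m - ψ y) ∂ν ≤ ∫ x, φ x ∂ν :=
        integral_mono (integrable_const _) (φ.integrable _) fun x => by
          have := hle x y
          have := hm (x, y)
          simp only
          linarith
      simp at this
      linarith
    have : ∫ _y, (m - ∫ x, φ x ∂ν) ∂μ ≤ ∫ y, ψ y ∂μ :=
      integral_mono (integrable_const _) (ψ.integrable _) h1
    simp at this
    linarith
  · have := hD (s⁻¹ • (BoundedContinuousFunction.const X m - φ)) (s⁻¹ • (-ψ)) fun x y => by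
      have h1 := hle x y
      have h2 := hm (x, y)
      have h3 : s⁻¹ * (m - φ x - ψ y) ≤ s⁻¹ * (s * c (x, y)) := by gcongr; linarith
      rw [inv_mul_cancel_left₀ hs.ne'] at h3
      simp only [BoundedContinuousFunction.coe_smul, BoundedContinuousFunction.coe_sub,
        BoundedContinuousFunction.coe_neg, Pi.sub_apply, Pi.neg_apply, smul_eq_mul,
        BoundedContinuousFunction.const_apply]
      linarith
    simp only [BoundedContinuousFunction.coe_smul, BoundedContinuousFunction.coe_sub,
        BoundedContinuousFunction.coe_neg, Pi.sub_apply, Pi.neg_apply, smul_eq_mul,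
        BoundedContinuousFunction.const_apply, integral_const_mul] at this
    rw [integral_sub (integrable_const _) (φ.integrable _), integral_neg, ← mul_add,
      inv_mul_le_iff₀ hs] at this
    simp at this
    linarith

end dualValues

/-- A linear functional on compactly supported functions that is dominated by the dual values. -/
theorem exists_linear_le_dualValues {X : Type*} [TopologicalSpace X] [MeasurableSpace X]
    [BorelSpace X] {ν μ : Measure X} [IsProbabilityMeasure ν] [IsProbabilityMeasure μ]
    {c : X × X → ℝ} {D : ℝ}
    (hD : ∀ φ ψ : X →ᵇ ℝ, (∀ x y, φ x + ψ y ≤ c (x, y)) → ∫ x, φ x ∂ν + ∫ y, ψ y ∂μ ≤ D) :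
    ∃ L : C_c(X × X, ℝ) →ₗ[ℝ] ℝ, ∀ h : C_c(X × X, ℝ), ∀ r ∈ dualValues ν μ c D h, L h ≤ r := by
  have hbd : ∀ h : C_c(X × X, ℝ), ∃ M, ∀ q, |h q| ≤ M := fun h => by
    simpa using h.hasCompactSupport.exists_bound_of_continuous h.continuous
  have hbb : ∀ h : C_c(X × X, ℝ), BddBelow (dualValues ν μ c D h) := fun h => by
    obtain ⟨M, hM⟩ := hbd h
    exact ⟨-M, fun r hr => le_of_mem_dualValues hD (fun q => (abs_le.1 (hM q)).1) hr⟩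
  have hne : ∀ h : C_c(X × X, ℝ), (dualValues ν μ c D h).Nonempty := fun h => by
    obtain ⟨M, hM⟩ := hbd h
    exact ⟨_, .const X M, 0, 0, le_rfl, fun x y => by simpa using (abs_le.1 (hM (x, y))).2, rfl⟩
  let N : C_c(X × X, ℝ) → ℝ := fun h => sInf (dualValues ν μ c D h)
  have hN : ∀ (a : ℝ), 0 < a → ∀ h, N (a • h) ≤ a * N h := fun a ha h => by
    rw [← div_le_iff₀' ha]
    refine le_csInf (hne h) fun r hr => ?_
    rw [div_le_iff₀' ha]
    exact csInf_le (hbb _) (dualValues_smul ha.le hr)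
  have hN_smul : ∀ a : ℝ, 0 < a → ∀ h, N (a • h) = a * N h := fun a ha h => by
    refine le_antisymm (hN a ha h) ?_
    have := hN a⁻¹ (inv_pos.2 ha) (a • h)
    rwa [inv_smul_smul₀ ha.ne', le_inv_mul_iff₀ ha] at this
  have hN_add : ∀ h k, N (h + k) ≤ N h + N k := fun h k => by
    have : ∀ r ∈ dualValues ν μ c D h, N (h + k) - N k ≤ r := fun r hr => by
      have : N (h + k) - r ≤ N k := le_csInf (hne k) fun t ht => by
        have := csInf_le (hbb (h + k)) (dualValues_add hr ht)
        simp only [N]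
        linarith
      linarith
    have := le_csInf (hne h) this
    simp only [N] at this ⊢
    linarith
  have hN_zero : 0 ≤ N 0 := le_csInf (hne _) fun r hr =>
    le_of_mem_dualValues hD (m := 0) (h := (0 : C_c(X × X, ℝ))) (by simp) hr
  obtain ⟨L, -, hL⟩ := exists_extension_of_le_sublinear (E := C_c(X × X, ℝ))
    (⟨⊥, 0⟩ : C_c(X × X, ℝ) →ₗ.[ℝ] ℝ) N hN_smul hN_add fun x => by
      obtain ⟨x, hx⟩ := x
      obtain rfl : x = 0 := by simpa using hx
      simpa using hN_zero
  exact ⟨L, fun h r hr => (hL h).trans (csInf_le (hbb _) hr)⟩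

/-- Compactly supported cutoff functions on a proper metric space. -/
noncomputable def cutoff {X : Type*} [MetricSpace X] (x₀ : X) (k : ℕ) (x : X) : ℝ :=
  max 0 (min 1 (k + 1 - dist x x₀))

section cutoff
variable {X : Type*} [MetricSpace X] (x₀ : X)

theorem continuous_cutoff (k : ℕ) : Continuous (cutoff x₀ k) := by
  unfold cutoff; fun_prop

theorem cutoff_nonneg (k : ℕ) (x : X) : 0 ≤ cutoff x₀ k x := le_max_left _ _

theorem cutoff_le_one (k : ℕ) (x : X) : cutoff x₀ k x ≤ 1 :=
  max_le zero_le_one (min_le_left _ _)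

theorem hasCompactSupport_cutoff [ProperSpace X] (k : ℕ) : HasCompactSupport (cutoff x₀ k) := by
  refine HasCompactSupport.intro (isCompact_closedBall x₀ (k + 1)) fun x hx => ?_
  rw [Metric.mem_closedBall, not_le] at hx
  exact max_eq_left ((min_le_right _ _).trans (by linarith))

theorem tendsto_cutoff (x : X) : Tendsto (fun k => cutoff x₀ k x) atTop (𝓝 1) := by
  refine tendsto_const_nhds.congr' ?_
  filter_upwards [eventually_ge_atTop ⌈dist x x₀⌉₊] with k hk
  have : dist x x₀ ≤ k := (Nat.le_ceil _).trans (by exact_mod_cast hk)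
  rw [cutoff, min_eq_left (by linarith), max_eq_right zero_le_one]

/-- The cutoff functions as bounded continuous functions. -/
noncomputable def cutoffBCF (k : ℕ) : X →ᵇ ℝ :=
  .ofNormedAddCommGroup (cutoff x₀ k) (continuous_cutoff x₀ k) 1 fun x => by
    rw [Real.norm_of_nonneg (cutoff_nonneg x₀ k x)]; exact cutoff_le_one x₀ k x

/-- The product of two cutoff functions. -/
noncomputable def cutoffProd [ProperSpace X] (k : ℕ) (F : X × X → ℝ) (hF : Continuous F) :
    C_c(X × X, ℝ) where
  toFun q := cutoff x₀ k q.1 * cutoff x₀ k q.2 * F q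
  continuous_toFun := by have := continuous_cutoff x₀ k; fun_prop
  hasCompactSupport' := by
    have h := hasCompactSupport_cutoff x₀ k
    refine HasCompactSupport.intro (h.isCompact.prod h.isCompact) fun q hq => ?_
    rw [Set.mem_prod, not_and_or] at hq
    rcases hq with hq | hq <;> simp [image_eq_zero_of_notMem_tsupport hq]

end cutoff

/-- Kantorovich duality: a bound for all dual pairs produces a coupling with cost at most that
bound. -/
theorem exists_coupling_of_dual_le {X : Type*} [MetricSpace X] [ProperSpace X] [MeasurableSpace X]
    [BorelSpace X] {ν μ : Measure X} [IsProbabilityMeasure ν] [IsProbabilityMeasure μ]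
    {c : X × X → ℝ} (hc : Continuous c) (hc0 : ∀ q, 0 ≤ c q) {D : ℝ}
    (hD : ∀ φ ψ : X →ᵇ ℝ, (∀ x y, φ x + ψ y ≤ c (x, y)) → ∫ x, φ x ∂ν + ∫ y, ψ y ∂μ ≤ D) :
    ∃ π : Measure (X × X), π.map Prod.fst = ν ∧ π.map Prod.snd = μ ∧
      ∫⁻ q, ENNReal.ofReal (c q) ∂π ≤ ENNReal.ofReal D := by
  obtain ⟨x₀⟩ : Nonempty X := nonempty_of_isProbabilityMeasure ν
  obtain ⟨L, hL⟩ := exists_linear_le_dualValues hD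
  have hLpos : ∀ h : C_c(X × X, ℝ), 0 ≤ h → 0 ≤ L h := fun h hh => by
    have := hL (-h) 0 ⟨0, 0, 0, le_rfl, fun x y => by simpa using hh (x, y), by simp⟩
    rw [map_neg] at this
    linarith
  let Λ : C_c(X × X, ℝ) →ₚ[ℝ] ℝ := PositiveLinearMap.mk₀ L hLpos
  let π := RealRMK.rieszMeasure Λ
  have hπ : ∀ h : C_c(X × X, ℝ), ∫ q, h q ∂π = L h := RealRMK.integral_rieszMeasure Λ
  have hlim : ∀ q : X × X, Tendsto (fun k => cutoff x₀ k q.1 * cutoff x₀ k q.2) atTop (𝓝 1) :=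
    fun q => by simpa using (tendsto_cutoff x₀ q.1).mul (tendsto_cutoff x₀ q.2)
  have hle1 : ∀ k (q : X × X), cutoff x₀ k q.1 * cutoff x₀ k q.2 ≤ 1 := fun k q =>
    mul_le_one₀ (cutoff_le_one _ _ _) (cutoff_nonneg _ _ _) (cutoff_le_one _ _ _)
  have hge0 : ∀ k (q : X × X), 0 ≤ cutoff x₀ k q.1 * cutoff x₀ k q.2 := fun k q =>
    mul_nonneg (cutoff_nonneg _ _ _) (cutoff_nonneg _ _ _)
  have hint : ∀ h : C_c(X × X, ℝ), Integrable h π := fun h =>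
    h.continuous.integrable_of_hasCompactSupport h.hasCompactSupport
  have key : ∀ F : X × X → ℝ, Continuous F → (∀ q, 0 ≤ F q) → ∀ (φ ψ : X →ᵇ ℝ) (s : ℝ), 0 ≤ s →
      (∀ x y, F (x, y) ≤ φ x + ψ y + s * c (x, y)) →
      ∫⁻ q, ENNReal.ofReal (F q) ∂π ≤
        ENNReal.ofReal (∫ x, φ x ∂ν + ∫ y, ψ y ∂μ + s * D) := by
    intro F hF hF0 φ ψ s hs hle
    have h1 : ∀ k, ∫⁻ q, ENNReal.ofReal (cutoffProd x₀ k F hF q) ∂π ≤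
        ENNReal.ofReal (∫ x, φ x ∂ν + ∫ y, ψ y ∂μ + s * D) := fun k => by
      rw [← ofReal_integral_eq_lintegral_ofReal (hint _)
        (Eventually.of_forall fun q => mul_nonneg (hge0 k q) (hF0 q)), hπ]
      refine ENNReal.ofReal_le_ofReal (hL _ _ ⟨φ, ψ, s, hs, fun x y => ?_, rfl⟩)
      exact (mul_le_of_le_one_left (hF0 _) (hle1 k (x, y))).trans (hle x y)
    calc ∫⁻ q, ENNReal.ofReal (F q) ∂π
        = ∫⁻ q, liminf (fun k => ENNReal.ofReal (cutoffProd x₀ k F hF q)) atTop ∂π := by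
          refine lintegral_congr fun q => (Tendsto.liminf_eq ?_).symm
          refine (ENNReal.continuous_ofReal.tendsto _).comp ?_
          have := (hlim q).mul_const (F q)
          rwa [one_mul] at this
      _ ≤ liminf (fun k => ∫⁻ q, ENNReal.ofReal (cutoffProd x₀ k F hF q) ∂π) atTop :=
          lintegral_liminf_le fun k => by
            have := (cutoffProd x₀ k F hF).continuous
            exact (ENNReal.continuous_ofReal.comp this).measurable
      _ ≤ _ := liminf_le_of_le (by isBoundedDefault) fun b hb => by
          obtain ⟨k, hk⟩ := hb.exists
          exact hk.trans (h1 k)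
  have hmass_le : π Set.univ ≤ 1 := by
    have := key (fun _ => 1) continuous_const (fun _ => zero_le_one) (.const X 1) 0 0 le_rfl
      (fun x y => by simp)
    simpa using this
  have : IsFiniteMeasure π := ⟨hmass_le.trans_lt ENNReal.one_lt_top⟩
  have hmass_ge : 1 ≤ π Set.univ := by
    have h1 : ∀ k, ENNReal.ofReal (∫ x, cutoff x₀ k x ∂ν + ∫ x, cutoff x₀ k x ∂μ - 1) ≤
        π Set.univ := fun k => by
      have h2 := hL (-cutoffProd x₀ k (fun _ => 1) continuous_const) _
        ⟨.const X 1 - cutoffBCF x₀ k, - cutoffBCF x₀ k, 0, le_rfl, fun x y => ?_, rfl⟩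
      · have h3 : L (cutoffProd x₀ k (fun _ => 1) continuous_const) ≤ π.real Set.univ := by
          rw [← hπ]
          have : ∫ _q, (1 : ℝ) ∂π = π.real Set.univ := by simp
          rw [← this]
          refine integral_mono (hint _) (integrable_const _) fun q => ?_
          simpa [cutoffProd] using hle1 k q
        have h4 : ∫ x, ((BoundedContinuousFunction.const X (1 : ℝ) - cutoffBCF x₀ k) x) ∂ν
            = 1 - ∫ x, cutoff x₀ k x ∂ν := by
          have := integral_sub (μ := ν) (integrable_const (1 : ℝ)) ((cutoffBCF x₀ k).integrable ν)
          simpa [cutoffBCF] using this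
        have h5 : ∫ x, ((-cutoffBCF x₀ k : X →ᵇ ℝ) x) ∂μ = - ∫ x, cutoff x₀ k x ∂μ := by
          rw [← integral_neg]; rfl
        rw [h4, h5, map_neg] at h2
        rw [← ENNReal.ofReal_toReal (measure_ne_top π Set.univ)]
        refine ENNReal.ofReal_le_ofReal ?_
        change _ ≤ π.real Set.univ
        linarith
      · change -(cutoff x₀ k x * cutoff x₀ k y * 1) ≤
          1 - cutoff x₀ k x + -cutoff x₀ k y + 0 * c (x, y)
        nlinarith [cutoff_le_one x₀ k x, cutoff_le_one x₀ k y]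
    have h2 : ∀ P : Measure X, IsProbabilityMeasure P →
        Tendsto (fun k => ∫ x, cutoff x₀ k x ∂P) atTop (𝓝 1) := fun P _ => by
      have := tendsto_integral_of_dominated_convergence (μ := P) (F := fun k => cutoff x₀ k)
        (f := fun _ => 1) (fun _ => 1)
        (fun k => (continuous_cutoff x₀ k).aestronglyMeasurable) (integrable_const _)
        (fun k => Eventually.of_forall fun x => by
          rw [Real.norm_of_nonneg (cutoff_nonneg x₀ k x)]; exact cutoff_le_one x₀ k x)
        (Eventually.of_forall fun x => tendsto_cutoff x₀ x)
      simpa using this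
    have h3 := (ENNReal.continuous_ofReal.tendsto _).comp
      (((h2 ν inferInstance).add (h2 μ inferInstance)).sub_const 1)
    have := le_of_tendsto' h3 h1
    simpa using this
  have hprob : IsProbabilityMeasure π := ⟨le_antisymm hmass_le hmass_ge⟩
  have h1 : IsProbabilityMeasure (π.map Prod.fst) :=
    Measure.isProbabilityMeasure_map measurable_fst.aemeasurable
  have h2 : IsProbabilityMeasure (π.map Prod.snd) :=
    Measure.isProbabilityMeasure_map measurable_snd.aemeasurable
  have hbcf : ∀ (f : X →ᵇ ℝ≥0) (P : Measure X) [IsProbabilityMeasure P],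
      ∃ g : X →ᵇ ℝ, (∀ x, g x = f x) ∧ ENNReal.ofReal (∫ x, g x ∂P) = ∫⁻ x, f x ∂P := by
    intro f P _
    have hg : ∀ x, ‖(f x : ℝ)‖ ≤ nndist f 0 := fun x => by
      rw [Real.norm_of_nonneg (NNReal.coe_nonneg _)]; exact NNReal.upper_bound f x
    refine ⟨.ofNormedAddCommGroup (fun x => (f x : ℝ)) (by fun_prop) _ hg, fun x => rfl, ?_⟩
    rw [ofReal_integral_eq_lintegral_ofReal (BoundedContinuousFunction.integrable _ _)
      (Eventually.of_forall fun x => (f x).2)]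
    exact lintegral_congr fun x => by simp
  refine ⟨π, ext_of_forall_lintegral_le fun f => ?_, ext_of_forall_lintegral_le fun f => ?_, ?_⟩
  · obtain ⟨g, hgf, hg⟩ := hbcf f ν
    rw [lintegral_map (by fun_prop) measurable_fst]
    have := key (fun q => g q.1) (by fun_prop) (fun q => by simp [hgf]) g 0 0 le_rfl (by simp)
    simpa [hgf, ← hg] using this
  · obtain ⟨g, hgf, hg⟩ := hbcf f μ
    rw [lintegral_map (by fun_prop) measurable_snd]
    have := key (fun q => g q.2) (by fun_prop) (fun q => by simp [hgf]) 0 g 0 le_rfl (by simp)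
    simpa [hgf, ← hg] using this
  · simpa using key c hc hc0 0 0 1 zero_le_one (by simp)

end Duality

section WeakGradient

open Filter Topology ContinuousLinearMap
open scoped ContDiff Convolution

variable {E : Type*} [NormedAddCommGroup E] [InnerProductSpace ℝ E] [FiniteDimensional ℝ E]
  [MeasurableSpace E] [BorelSpace E] {m : Measure E} [m.IsAddHaarMeasure]

/-- `G` is the distributional gradient of `g` with respect to the reference measure `m`. -/
def HasWeakGradient (m : Measure E) (g : E → ℝ) (G : E → E) : Prop :=
  ∀ η : E → ℝ, ContDiff ℝ ∞ η → HasCompactSupport η → ∀ v : E,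
    ∫ x, fderiv ℝ η x v * g x ∂m = -∫ x, η x * inner ℝ (G x) v ∂m

theorem HasWeakGradient.fderiv_convolution {g : E → ℝ} {G : E → E} (h : HasWeakGradient m g G)
    (hg : LocallyIntegrable g m) {ρ : E → ℝ} (hρ : ContDiff ℝ ∞ ρ) (hρc : HasCompactSupport ρ)
    (x v : E) :
    fderiv ℝ (ρ ⋆[lsmul ℝ ℝ, m] g) x v = ∫ y, ρ (x - y) * inner ℝ (G y) v ∂m := by
  have hρ1 : ContDiff ℝ 1 ρ := hρ.of_le (by exact_mod_cast le_top)
  rw [(hρc.hasFDerivAt_convolution_left (lsmul ℝ ℝ) hρ1 hg x).fderiv, convolution_eq_swap,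
    ContinuousLinearMap.integral_apply]
  · have hd : ∀ y, fderiv ℝ (fun z => ρ (x - z)) y v = -(fderiv ℝ ρ (x - y) v) := fun y => by
      have h1 := (hρ1.differentiable one_ne_zero (x - y)).hasFDerivAt
      have h2 := h1.comp y ((hasFDerivAt_id y).const_sub x)
      have h3 := congrArg (fun T : E →L[ℝ] ℝ => T v) h2.fderiv
      simpa [Function.comp_def] using h3
    have h1 := h (fun y => ρ (x - y)) (by fun_prop)
      (hρc.comp_homeomorph (Homeomorph.subLeft x)) v
    simp only [hd, neg_mul, integral_neg, neg_inj] at h1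
    exact h1
  · have := ((hρc.fderiv (𝕜 := ℝ)).convolutionExists_left ((lsmul ℝ ℝ).precompL E)
      (hρ1.continuous_fderiv one_ne_zero) hg x)
    exact this.integrable_swap

theorem HasWeakGradient.enorm_fderiv_convolution_le {g : E → ℝ} {G : E → E}
    (h : HasWeakGradient m g G) (hg : LocallyIntegrable g m) {ρ : E → ℝ} (hρ : ContDiff ℝ ∞ ρ)
    (hρc : HasCompactSupport ρ) (x : E) :
    ‖fderiv ℝ (ρ ⋆[lsmul ℝ ℝ, m] g) x‖ₑ ≤ ∫⁻ y, ‖ρ (x - y)‖ₑ * ‖G y‖ₑ ∂m := by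
  by_cases htop : ∫⁻ y, ‖ρ (x - y)‖ₑ * ‖G y‖ₑ ∂m = ⊤
  · simp [htop]
  rw [← ENNReal.ofReal_toReal htop, ← ofReal_norm]
  refine ENNReal.ofReal_le_ofReal
    (ContinuousLinearMap.opNorm_le_bound _ ENNReal.toReal_nonneg fun v => ?_)
  rw [h.fderiv_convolution hg hρ hρc, ← toReal_enorm, ← toReal_enorm (x := v), ← ENNReal.toReal_mul]
  refine ENNReal.toReal_mono (ENNReal.mul_ne_top htop enorm_ne_top) ?_
  refine (enorm_integral_le_lintegral_enorm _).trans ?_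
  rw [← lintegral_mul_const' _ _ enorm_ne_top]
  refine lintegral_mono fun y => ?_
  rw [enorm_mul, mul_assoc]
  gcongr
  simp only [enorm_eq_nnnorm]
  exact_mod_cast nnnorm_inner_le_nnnorm (𝕜 := ℝ) (G y) v

theorem sq_lintegral_mul_le {α : Type*} [MeasurableSpace α] {κ : Measure α} {p f : α → ℝ≥0∞}
    (hp : AEMeasurable p κ) (hf : AEMeasurable f κ) (h1 : ∫⁻ y, p y ∂κ = 1) :
    (∫⁻ y, p y * f y ∂κ) ^ 2 ≤ ∫⁻ y, p y * f y ^ 2 ∂κ := by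
  have h := ENNReal.lintegral_mul_le_Lp_mul_Lq κ Real.HolderConjugate.two_two
    (f := fun y => p y ^ (1 / 2 : ℝ)) (g := fun y => p y ^ (1 / 2 : ℝ) * f y) (by fun_prop)
    (by fun_prop)
  have e1 : ∀ y, p y ^ (1 / 2 : ℝ) * (p y ^ (1 / 2 : ℝ) * f y) = p y * f y := fun y => by
    rw [← mul_assoc, ← ENNReal.rpow_add_of_nonneg _ _ (by norm_num) (by norm_num)]
    norm_num
  have e2 : ∀ y, (p y ^ (1 / 2 : ℝ)) ^ (2 : ℝ) = p y := fun y => by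
    rw [← ENNReal.rpow_mul]; norm_num
  have e3 : ∀ y, (p y ^ (1 / 2 : ℝ) * f y) ^ (2 : ℝ) = p y * f y ^ 2 := fun y => by
    rw [ENNReal.mul_rpow_of_nonneg _ _ (by norm_num), e2]; norm_num
  simp only [Pi.mul_apply, e1, e2, e3, h1, ENNReal.one_rpow, one_mul] at h
  calc (∫⁻ y, p y * f y ∂κ) ^ 2 ≤ ((∫⁻ y, p y * f y ^ 2 ∂κ) ^ (1 / 2 : ℝ)) ^ 2 := by gcongr
    _ = _ := by
      rw [← ENNReal.rpow_natCast, ← ENNReal.rpow_mul]; norm_num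

omit [MeasurableSpace E] [BorelSpace E] in
theorem exists_local_doubling {w : E → ℝ} (hw : Continuous w) (hw0 : ∀ x, 0 < w x) (R : ℝ)
    {η : ℝ} (hη : 0 < η) :
    ∃ ε > 0, ∀ x y, ‖x‖ ≤ R → ‖x - y‖ ≤ ε → w x ≤ (1 + η) * w y := by
  have hK : IsCompact (Metric.closedBall (0 : E) (R + 1)) := isCompact_closedBall _ _
  by_cases hR : 0 ≤ R
  · obtain ⟨z, -, hz⟩ := hK.exists_isMinOn ⟨0, by simp; linarith⟩ hw.continuousOn
    have huc := hK.uniformContinuousOn_of_continuous hw.continuousOn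
    obtain ⟨ε, hε, h⟩ := Metric.uniformContinuousOn_iff.1 huc (η * w z) (mul_pos hη (hw0 z))
    refine ⟨min (ε / 2) 1, by positivity, fun x y hx hxy => ?_⟩
    have hy : y ∈ Metric.closedBall (0 : E) (R + 1) := by
      rw [mem_closedBall_zero_iff]
      have := norm_sub_norm_le y x
      rw [norm_sub_rev] at this
      linarith [min_le_right (ε / 2) 1]
    have h1 := h x (by rw [mem_closedBall_zero_iff]; linarith) y hy
      (by rw [dist_eq_norm]; linarith [min_le_left (ε / 2) 1])
    have h2 : η * w z ≤ η * w y := mul_le_mul_of_nonneg_left (hz hy) hη.le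
    rw [Real.dist_eq] at h1
    linarith [le_abs_self (w x - w y)]
  · exact ⟨1, one_pos, fun x y hx _ => absurd ((norm_nonneg x).trans hx) hR⟩

theorem lintegral_indicator_average_le {w : E → ℝ} (hw : Continuous w)
    {s : Set E} (hs : MeasurableSet s) {ρ : E → ℝ} (hρ : Continuous ρ) (hρ0 : ∀ x, 0 ≤ ρ x)
    (hρ1 : ∫ x, ρ x ∂m = 1) (hρi : Integrable ρ m) {η : ℝ} (hη : 0 ≤ η)
    (hle : ∀ x y, x ∈ s → ρ (x - y) ≠ 0 → w x ≤ (1 + η) * w y) {f : E → ℝ≥0∞}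
    (hf : AEMeasurable f m) :
    ∫⁻ x in s, ∫⁻ y, ‖ρ (x - y)‖ₑ * f y ∂m ∂(m.withDensity fun x => ENNReal.ofReal (w x)) ≤
      ENNReal.ofReal (1 + η) * ∫⁻ y, f y ∂(m.withDensity fun x => ENNReal.ofReal (w x)) := by
  have hwm : Measurable fun x => ENNReal.ofReal (w x) := by fun_prop
  rw [restrict_withDensity hs, lintegral_withDensity_eq_lintegral_mul_non_measurable _ hwm
    (by simp), lintegral_withDensity_eq_lintegral_mul_non_measurable _ hwm (by simp)]
  simp only [Pi.mul_apply]
  have hρm := hρ.measurable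
  have hρe : ∫⁻ x, ‖ρ x‖ₑ ∂m = 1 := by
    rw [← ofReal_integral_norm_eq_lintegral_enorm hρi]
    simp only [Real.norm_of_nonneg (hρ0 _), hρ1, ENNReal.ofReal_one]
  calc ∫⁻ x in s, ENNReal.ofReal (w x) * ∫⁻ y, ‖ρ (x - y)‖ₑ * f y ∂m ∂m
      ≤ ∫⁻ x in s, ∫⁻ y, ENNReal.ofReal (1 + η) * (‖ρ (x - y)‖ₑ *
          (ENNReal.ofReal (w y) * f y)) ∂m ∂m := by
        refine setLIntegral_mono' hs fun x hx => ?_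
        rw [← lintegral_const_mul' _ _ ENNReal.ofReal_ne_top]
        refine lintegral_mono fun y => ?_
        by_cases h0 : ρ (x - y) = 0
        · simp [h0]
        calc ENNReal.ofReal (w x) * (‖ρ (x - y)‖ₑ * f y)
            ≤ ENNReal.ofReal ((1 + η) * w y) * (‖ρ (x - y)‖ₑ * f y) := by
              gcongr; exact hle x y hx h0
          _ = _ := by rw [ENNReal.ofReal_mul (by linarith)]; ring
    _ ≤ ∫⁻ x, ∫⁻ y, ENNReal.ofReal (1 + η) * (‖ρ (x - y)‖ₑ *
          (ENNReal.ofReal (w y) * f y)) ∂m ∂m := setLIntegral_le_lintegral _ _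
    _ = ∫⁻ y, ∫⁻ x, ENNReal.ofReal (1 + η) * (‖ρ (x - y)‖ₑ *
          (ENNReal.ofReal (w y) * f y)) ∂m ∂m := by
        refine lintegral_lintegral_swap ?_
        have h1 : AEMeasurable (fun z : E × E => f z.2) (m.prod m) :=
          hf.comp_quasiMeasurePreserving Measure.quasiMeasurePreserving_snd
        have h2 : Measurable fun z : E × E => ‖ρ (z.1 - z.2)‖ₑ := by fun_prop
        have h3 : Measurable fun z : E × E => ENNReal.ofReal (w z.2) := by fun_prop
        exact ((h2.aemeasurable.mul (h3.aemeasurable.mul h1)).const_mul _)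
    _ = _ := by
        rw [← lintegral_const_mul' _ _ ENNReal.ofReal_ne_top]
        refine lintegral_congr fun y => ?_
        have : Measurable fun x => ‖ρ (x - y)‖ₑ := by fun_prop
        rw [lintegral_const_mul' _ _ ENNReal.ofReal_ne_top, lintegral_mul_const _ this,
          lintegral_sub_right_eq_self (fun x => ‖ρ x‖ₑ) y, hρe, one_mul]

omit [MeasurableSpace E] [BorelSpace E] in
theorem exists_smooth_cutoff : ∃ c : ℝ, 0 ≤ c ∧ ∀ R : ℝ, 0 < R → ∃ χ : E → ℝ, ContDiff ℝ 1 χ ∧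
    (∀ x, 0 ≤ χ x) ∧ (∀ x, χ x ≤ 1) ∧ (∀ x, ‖x‖ ≤ R → χ x = 1) ∧ (∀ x, χ x ≠ 0 → ‖x‖ ≤ 2 * R) ∧
    ∀ x, ‖fderiv ℝ χ x‖ ≤ c / R := by
  let b : ContDiffBump (0 : E) := ⟨1, 2, one_pos, one_lt_two⟩
  have hb : ContDiff ℝ 1 b := b.contDiff
  obtain ⟨c, hc⟩ := (b.hasCompactSupport.fderiv (𝕜 := ℝ)).exists_bound_of_continuous
    (hb.continuous_fderiv one_ne_zero)
  refine ⟨c, (norm_nonneg _).trans (hc 0), fun R hR => ⟨fun x => b (R⁻¹ • x), by fun_prop,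
    fun x => b.nonneg, fun x => b.le_one, fun x hx => ?_, fun x hx => ?_, fun x => ?_⟩⟩
  · refine b.one_of_mem_closedBall ?_
    rw [mem_closedBall_zero_iff, norm_smul, norm_inv, Real.norm_of_nonneg hR.le,
      inv_mul_le_iff₀ hR]
    simpa [b] using hx
  · have : R⁻¹ • x ∈ Function.support b := hx
    rw [b.support_eq, mem_ball_zero_iff, norm_smul, norm_inv, Real.norm_of_nonneg hR.le,
      inv_mul_lt_iff₀ hR] at this
    simp only [b] at this
    linarith
  · have h1 := (hb.differentiable one_ne_zero (R⁻¹ • x)).hasFDerivAt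
    have h2 := h1.comp x ((hasFDerivAt_id x).const_smul R⁻¹)
    have h3 : fderiv ℝ (fun x => b (R⁻¹ • x)) x = R⁻¹ • fderiv ℝ b (R⁻¹ • x) := by
      have := h2.fderiv
      simpa [Function.comp_def] using this
    rw [h3, norm_smul, norm_inv, Real.norm_of_nonneg hR.le, div_eq_inv_mul]
    gcongr
    exact hc _

omit [FiniteDimensional ℝ E] [MeasurableSpace E] [BorelSpace E] in
theorem enorm_fderiv_mul_sq_le {χ g : E → ℝ} {x : E} (hχ : DifferentiableAt ℝ χ x)
    (hg : DifferentiableAt ℝ g x) {a s : ℝ}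
    (ha : |g x| * ‖fderiv ℝ χ x‖ ≤ a) (hs : 0 < s) :
    ‖fderiv ℝ (fun y => χ y * g y) x‖ₑ ^ 2 ≤
      ENNReal.ofReal (1 + s) * ‖χ x • fderiv ℝ g x‖ₑ ^ 2 + ENNReal.ofReal ((1 + s⁻¹) * a ^ 2) := by
  rw [fderiv_fun_mul hχ hg, ← ofReal_norm, ← ofReal_norm, ← ENNReal.ofReal_pow (norm_nonneg _),
    ← ENNReal.ofReal_pow (norm_nonneg _), ← ENNReal.ofReal_mul (by positivity),
    ← ENNReal.ofReal_add (by positivity) (by positivity)]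
  refine ENNReal.ofReal_le_ofReal ?_
  have h1 := norm_add_le (χ x • fderiv ℝ g x) (g x • fderiv ℝ χ x)
  rw [norm_smul (g x), Real.norm_eq_abs] at h1
  have h2 : ‖χ x • fderiv ℝ g x + g x • fderiv ℝ χ x‖ ≤ ‖χ x • fderiv ℝ g x‖ + a := by linarith
  calc _ ≤ (‖χ x • fderiv ℝ g x‖ + a) ^ 2 := by gcongr
    _ ≤ _ := by
      have h3 : 0 ≤ s⁻¹ * (s * ‖χ x • fderiv ℝ g x‖ - a) ^ 2 := by positivity
      have h4 : s⁻¹ * (s * ‖χ x • fderiv ℝ g x‖ - a) ^ 2 = s * ‖χ x • fderiv ℝ g x‖ ^ 2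
        - 2 * ‖χ x • fderiv ℝ g x‖ * a + s⁻¹ * a ^ 2 := by field_simp; ring
      linarith

/-- Bounded functions with a distributional gradient are limits of bounded `C¹` functions, with
control of the energy. -/
theorem HasWeakGradient.exists_approx {w : E → ℝ} (hw : Continuous w) (hw0 : ∀ x, 0 < w x)
    {μ : Measure E} (hμ : μ = m.withDensity fun x => ENNReal.ofReal (w x))
    [IsProbabilityMeasure μ] {g : E → ℝ} {G : E → E} (h : HasWeakGradient m g G)
    (hg : Measurable g) {M : ℝ} (hM : ∀ x, |g x| ≤ M) (hG : AEMeasurable G m) :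
    ∃ (u : ℕ → E → ℝ) (a b : ℕ → ℝ), (∀ k, ContDiff ℝ 1 (u k)) ∧ (∀ k x, |u k x| ≤ M) ∧
      (∀ᵐ x ∂μ, Tendsto (fun k => u k x) atTop (𝓝 (g x))) ∧
      Tendsto a atTop (𝓝 1) ∧ Tendsto b atTop (𝓝 0) ∧
      ∀ k, ∫⁻ x, ‖fderiv ℝ (u k) x‖ₑ ^ 2 ∂μ ≤
        ENNReal.ofReal (a k) * ∫⁻ x, ‖G x‖ₑ ^ 2 ∂μ + ENNReal.ofReal (b k) := by
  obtain ⟨c, hc0, hc⟩ := exists_smooth_cutoff (E := E)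
  have hR : ∀ k : ℕ, (0 : ℝ) < k + 1 := fun k => by positivity
  have hM0 : 0 ≤ M := (abs_nonneg _).trans (hM 0)
  choose χ hχd hχ0 hχ1 hχeq hχs hχg using fun k : ℕ => hc (k + 1) (hR k)
  choose ε hε hdoub using fun k : ℕ =>
    exists_local_doubling hw hw0 (2 * ((k : ℝ) + 1)) (η := ((k : ℝ) + 1)⁻¹) (inv_pos.2 (hR k))
  have hr : ∀ k : ℕ, 0 < min (ε k) ((k : ℝ) + 1)⁻¹ := fun k =>
    lt_min (hε k) (inv_pos.2 (hR k))
  let β : ℕ → ContDiffBump (0 : E) := fun k =>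
    ⟨min (ε k) ((k : ℝ) + 1)⁻¹ / 2, min (ε k) ((k : ℝ) + 1)⁻¹, half_pos (hr k), half_lt_self (hr k)⟩
  have hgl : LocallyIntegrable g m := by
    refine (locallyIntegrable_const M).mono hg.aestronglyMeasurable
      (Eventually.of_forall fun x => ?_)
    rw [Real.norm_eq_abs, Real.norm_of_nonneg hM0]
    exact hM x
  let ρ : ℕ → E → ℝ := fun k => (β k).normed m
  let v : ℕ → E → ℝ := fun k => ρ k ⋆[lsmul ℝ ℝ, m] g
  have hρd : ∀ k, ContDiff ℝ ∞ (ρ k) := fun k => (β k).contDiff_normed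
  have hρc : ∀ k, HasCompactSupport (ρ k) := fun k => (β k).hasCompactSupport_normed
  have hρ0 : ∀ k x, 0 ≤ ρ k x := fun k x => (β k).nonneg_normed x
  have hρi : ∀ k, Integrable (ρ k) m := fun k => (β k).integrable_normed
  have hρ1 : ∀ k, ∫ x, ρ k x ∂m = 1 := fun k => (β k).integral_normed
  have hvd : ∀ k, ContDiff ℝ 1 (v k) := fun k => by
    have : ContDiff ℝ ∞ (v k) := (hρc k).contDiff_convolution_left (lsmul ℝ ℝ) (hρd k) hgl
    exact this.of_le (by exact_mod_cast le_top)
  have hvM : ∀ k x, |v k x| ≤ M := fun k x => by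
    have h1 : Integrable (fun y => ρ k (x - y)) m := (hρi k).comp_sub_left x
    calc |v k x| = ‖∫ y, ρ k (x - y) * g y ∂m‖ := by
          simp only [v, convolution_lsmul_swap, smul_eq_mul, Real.norm_eq_abs]
      _ ≤ ∫ y, ρ k (x - y) * M ∂m := by
          refine norm_integral_le_of_norm_le (h1.mul_const M) (Eventually.of_forall fun y => ?_)
          rw [norm_mul, Real.norm_of_nonneg (hρ0 k _)]
          exact mul_le_mul_of_nonneg_left (hM y) (hρ0 k _)
      _ = M := by
          rw [integral_mul_const, integral_sub_left_eq_self (ρ k) m x, hρ1, one_mul]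
  have hab : ∀ k x, |χ k x| ≤ 1 := fun k x => by rw [abs_of_nonneg (hχ0 k x)]; exact hχ1 k x
  have hinv : Tendsto (fun k : ℕ => ((k : ℝ) + 1)⁻¹) atTop (𝓝 0) := by
    simpa [one_div] using tendsto_one_div_add_atTop_nhds_zero_nat (𝕜 := ℝ)
  refine ⟨fun k x => χ k x * v k x, fun k => (1 + ((k : ℝ) + 1)⁻¹) * (1 + ((k : ℝ) + 1)⁻¹),
    fun k => (1 + (((k : ℝ) + 1)⁻¹)⁻¹) * (M * (c / (k + 1))) ^ 2,
    fun k => (hχd k).mul (hvd k), fun k x => ?_, ?_, ?_, ?_, fun k => ?_⟩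
  · rw [abs_mul]
    exact (mul_le_mul (hab k x) (hvM k x) (abs_nonneg _) zero_le_one).trans_eq (one_mul M)
  · have hac : μ ≪ m := hμ ▸ withDensity_absolutelyContinuous _ _
    have hconv : ∀ᵐ x ∂m, Tendsto (fun k => v k x) atTop (𝓝 (g x)) := by
      refine ContDiffBump.ae_convolution_tendsto_right_of_locallyIntegrable (φ := β) (K := 2)
        ?_ (Eventually.of_forall fun k => ?_) hgl
      · exact squeeze_zero (fun k => (hr k).le) (fun k => min_le_right _ _) hinv
      · simp only [β]; linarith
    filter_upwards [hac.ae_le hconv] with x hx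
    refine hx.congr' ?_
    filter_upwards [eventually_ge_atTop ⌈‖x‖⌉₊] with k hk
    have : ‖x‖ ≤ k := (Nat.le_ceil _).trans (by exact_mod_cast hk)
    rw [hχeq k x (by linarith), one_mul]
  · simpa using (hinv.const_add 1).mul (hinv.const_add 1)
  · have h1 : ∀ k : ℕ, (1 + (((k : ℝ) + 1)⁻¹)⁻¹) * (M * (c / (k + 1))) ^ 2 =
        (((k : ℝ) + 1)⁻¹ ^ 2 + ((k : ℝ) + 1)⁻¹) * (M * c) ^ 2 := fun k => by
      have := (hR k).ne'
      field_simp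
    simp only [h1]
    simpa using ((hinv.pow 2).add hinv).mul_const ((M * c) ^ 2)
  · set s : Set E := {x | ‖x‖ ≤ 2 * ((k : ℝ) + 1)}
    have hs : MeasurableSet s := (isClosed_le continuous_norm continuous_const).measurableSet
    have hint : ∫⁻ x, ‖χ k x • fderiv ℝ (v k) x‖ₑ ^ 2 ∂μ ≤
        ENNReal.ofReal (1 + ((k : ℝ) + 1)⁻¹) * ∫⁻ x, ‖G x‖ₑ ^ 2 ∂μ := by
      have hGe : AEMeasurable (fun y => ‖G y‖ₑ ^ 2) m := by fun_prop
      have key := lintegral_indicator_average_le hw hs (hρd k).continuous (hρ0 k) (hρ1 k) (hρi k)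
        (inv_pos.2 (hR k)).le (fun x y hx hxy => hdoub k x y hx ?_) hGe
      · rw [← hμ] at key
        refine le_trans ?_ key
        rw [← lintegral_indicator hs]
        refine lintegral_mono fun x => ?_
        by_cases hx : x ∈ s
        · rw [Set.indicator_of_mem hx]
          have hsq := sq_lintegral_mul_le (κ := m) (p := fun y => ‖ρ k (x - y)‖ₑ)
            (f := fun y => ‖G y‖ₑ) ?_ (by fun_prop) ?_
          · refine le_trans ?_ hsq
            gcongr
            refine le_trans ?_ (h.enorm_fderiv_convolution_le hgl (hρd k) (hρc k) x)
            rw [enorm_smul]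
            refine mul_le_of_le_one_left zero_le ?_
            rw [← ofReal_norm, Real.norm_eq_abs]
            simpa using hab k x
          · have := (hρd k).continuous
            exact (by fun_prop : Continuous fun y => ‖ρ k (x - y)‖ₑ).aemeasurable
          · rw [lintegral_sub_left_eq_self (fun y => ‖ρ k y‖ₑ) x,
              ← ofReal_integral_norm_eq_lintegral_enorm (hρi k)]
            simp only [Real.norm_of_nonneg (hρ0 k _), hρ1, ENNReal.ofReal_one]
        · have : χ k x = 0 := by
            by_contra h0
            exact hx (hχs k x h0)
          rw [enorm_smul, this, enorm_zero, zero_mul, zero_pow two_ne_zero]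
          exact zero_le
      · have : x - y ∈ Function.support ((β k).normed m) := hxy
        rw [ContDiffBump.support_normed_eq, mem_ball_zero_iff] at this
        exact this.le.trans (min_le_left _ _)
    calc ∫⁻ x, ‖fderiv ℝ (fun y => χ k y * v k y) x‖ₑ ^ 2 ∂μ
        ≤ ∫⁻ x, (ENNReal.ofReal (1 + ((k : ℝ) + 1)⁻¹) * ‖χ k x • fderiv ℝ (v k) x‖ₑ ^ 2 +
          ENNReal.ofReal ((1 + (((k : ℝ) + 1)⁻¹)⁻¹) * (M * (c / (k + 1))) ^ 2)) ∂μ := by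
          refine lintegral_mono fun x => enorm_fderiv_mul_sq_le
            ((hχd k).differentiable one_ne_zero x) ((hvd k).differentiable one_ne_zero x)
            ?_ (inv_pos.2 (hR k))
          exact mul_le_mul (hvM k x) (hχg k x) (norm_nonneg _) hM0
      _ ≤ _ := by
          rw [lintegral_add_right _ measurable_const,
            lintegral_const_mul' _ _ ENNReal.ofReal_ne_top,
            lintegral_const, measure_univ, mul_one,
            ENNReal.ofReal_mul (by have := hR k; positivity : (0 : ℝ) ≤ 1 + ((k : ℝ) + 1)⁻¹),
            mul_assoc]
          gcongr

end WeakGradient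

section PowerLogSobolev

open Filter Topology
open scoped ContDiff

theorem tendsto_integral_comp_of_bounded {α : Type*} [MeasurableSpace α] {μ : Measure α}
    [IsFiniteMeasure μ] {Φ : ℝ → ℝ} (hΦ : Continuous Φ) {f : ℕ → α → ℝ} {g : α → ℝ} {M : ℝ}
    (hf : ∀ k, AEStronglyMeasurable (f k) μ) (hM : ∀ᶠ k in atTop, ∀ x, |f k x| ≤ M)
    (h : ∀ᵐ x ∂μ, Tendsto (fun k => f k x) atTop (𝓝 (g x))) :
    Tendsto (fun k => ∫ x, Φ (f k x) ∂μ) atTop (𝓝 (∫ x, Φ (g x) ∂μ)) := by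
  obtain ⟨B, hB⟩ := (isCompact_Icc (a := -M) (b := M)).exists_bound_of_continuousOn hΦ.continuousOn
  refine tendsto_integral_filter_of_dominated_convergence (fun _ => B)
    (Eventually.of_forall fun k => hΦ.comp_aestronglyMeasurable (hf k)) ?_ (integrable_const B) ?_
  · filter_upwards [hM] with k hk
    exact Eventually.of_forall fun x => hB _ (abs_le.1 (hk x))
  · filter_upwards [h] with x hx
    exact (hΦ.tendsto _).comp hx

theorem continuous_sq_mul_log_sq : Continuous fun x : ℝ => x ^ 2 * Real.log (x ^ 2) :=
  Real.continuous_mul_log.comp (continuous_pow 2)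

variable {E : Type*} [NormedAddCommGroup E] [InnerProductSpace ℝ E] [FiniteDimensional ℝ E]
  [MeasurableSpace E] [BorelSpace E] {m : Measure E} [m.IsAddHaarMeasure]

/-- The inequality `μ(g² log g²)^δ ≤ C μ(|∇g|²)` on bounded `C¹` functions. -/
def PowerLogSobolev (μ : Measure E) (δ C : ℝ) : Prop :=
  ∀ g : E → ℝ, ContDiff ℝ 1 g → (∃ M, ∀ x, |g x| ≤ M) → ∫ x, g x ^ 2 ∂μ = 1 →
    ENNReal.ofReal ((∫ x, g x ^ 2 * Real.log (g x ^ 2) ∂μ) ^ δ) ≤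
      ENNReal.ofReal C * ∫⁻ x, ‖fderiv ℝ g x‖ₑ ^ 2 ∂μ

theorem PowerLogSobolev.of_hasWeakGradient {μ : Measure E} {δ C : ℝ} (hL : PowerLogSobolev μ δ C)
    (hδ : 0 ≤ δ) {w : E → ℝ} (hw : Continuous w) (hw0 : ∀ x, 0 < w x)
    (hμ : μ = m.withDensity fun x => ENNReal.ofReal (w x)) [IsProbabilityMeasure μ]
    {g : E → ℝ} {G : E → E} (h : HasWeakGradient m g G) (hg : Measurable g) {M : ℝ}
    (hM : ∀ x, |g x| ≤ M) (hG : AEMeasurable G m) (h1 : ∫ x, g x ^ 2 ∂μ = 1) :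
    ENNReal.ofReal ((∫ x, g x ^ 2 * Real.log (g x ^ 2) ∂μ) ^ δ) ≤
      ENNReal.ofReal C * ∫⁻ x, ‖G x‖ₑ ^ 2 ∂μ := by
  obtain ⟨u, a, b, hud, huM, hu, ha, hb, hab⟩ := h.exists_approx hw hw0 hμ hg hM hG
  have hum : ∀ k, AEStronglyMeasurable (u k) μ := fun k => (hud k).continuous.aestronglyMeasurable
  have hN : Tendsto (fun k => ∫ x, u k x ^ 2 ∂μ) atTop (𝓝 1) :=
    h1 ▸ tendsto_integral_comp_of_bounded (continuous_pow 2) hum (Eventually.of_forall huM) hu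
  set N : ℕ → ℝ := fun k => ∫ x, u k x ^ 2 ∂μ
  have hs : Tendsto (fun k => (√(N k))⁻¹) atTop (𝓝 1) := by
    simpa using (hN.sqrt).inv₀ (by simp)
  have hv : ∀ᵐ x ∂μ, Tendsto (fun k => (√(N k))⁻¹ * u k x) atTop (𝓝 (g x)) := by
    filter_upwards [hu] with x hx
    simpa using hs.mul hx
  have hent := tendsto_integral_comp_of_bounded (M := 2 * M) continuous_sq_mul_log_sq
    (fun k => (hum k).const_mul _) ?_ hv
  · have hl := ENNReal.tendsto_ofReal (((Real.continuous_rpow_const hδ).tendsto _).comp hent)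
    have hr : Tendsto (fun k => ENNReal.ofReal C * (ENNReal.ofReal ((√(N k))⁻¹ ^ 2) *
        (ENNReal.ofReal (a k) * ∫⁻ x, ‖G x‖ₑ ^ 2 ∂μ + ENNReal.ofReal (b k)))) atTop
        (𝓝 (ENNReal.ofReal C * (ENNReal.ofReal (1 ^ 2) *
          (ENNReal.ofReal 1 * ∫⁻ x, ‖G x‖ₑ ^ 2 ∂μ + ENNReal.ofReal 0)))) := by
      refine ENNReal.Tendsto.const_mul (ENNReal.Tendsto.mul (ENNReal.tendsto_ofReal (hs.pow 2))
        (.inl (by simp)) ((ENNReal.Tendsto.mul_const (ENNReal.tendsto_ofReal ha)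
          (.inl (by simp))).add (ENNReal.tendsto_ofReal hb)) (.inr (by simp)))
          (.inr ENNReal.ofReal_ne_top)
    simp only [one_pow, ENNReal.ofReal_one, one_mul, ENNReal.ofReal_zero, add_zero] at hr
    refine le_of_tendsto_of_tendsto hl hr ?_
    filter_upwards [hN.eventually_const_lt one_pos] with k hk
    have h2 : ∫ x, ((√(N k))⁻¹ * u k x) ^ 2 ∂μ = 1 := by
      simp only [mul_pow, integral_const_mul, inv_pow]
      rw [Real.sq_sqrt hk.le]
      exact inv_mul_cancel₀ hk.ne'
    refine (hL _ (contDiff_const.mul (hud k)) ⟨(√(N k))⁻¹ * M, fun x => ?_⟩ h2).trans ?_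
    · rw [abs_mul, abs_of_nonneg (by positivity : 0 ≤ (√(N k))⁻¹)]
      exact mul_le_mul_of_nonneg_left (huM k x) (by positivity)
    · gcongr
      calc ∫⁻ x, ‖fderiv ℝ (fun y => (√(N k))⁻¹ * u k y) x‖ₑ ^ 2 ∂μ
          = ∫⁻ x, ENNReal.ofReal ((√(N k))⁻¹ ^ 2) * ‖fderiv ℝ (u k) x‖ₑ ^ 2 ∂μ := by
            refine lintegral_congr fun x => ?_
            rw [fderiv_const_mul ((hud k).differentiable one_ne_zero x), enorm_smul, mul_pow,
              ← ofReal_norm, Real.norm_of_nonneg (by positivity),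
              ENNReal.ofReal_pow (by positivity)]
        _ ≤ _ := by
            rw [lintegral_const_mul' _ _ ENNReal.ofReal_ne_top]
            gcongr
            exact hab k
  · filter_upwards [Tendsto.eventually_le_const (one_lt_two (α := ℝ)) hs] with k hk x
    rw [abs_mul, abs_of_nonneg (by positivity : 0 ≤ (√(N k))⁻¹)]
    exact mul_le_mul hk (huM k x) (abs_nonneg _) zero_le_two

theorem hasWeakGradient_of_lipschitzWith {g : E → ℝ} {K : ℝ≥0} (hg : LipschitzWith K g) :
    HasWeakGradient m g (gradient g) := by
  intro η hη hηc v
  have hη1 : ContDiff ℝ 1 η := hη.of_le (by exact_mod_cast le_top)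
  obtain ⟨D, hD⟩ := hη1.lipschitzWith_of_hasCompactSupport hηc one_ne_zero
  have h := LipschitzWith.integral_lineDeriv_mul_eq (μ := m) hg hD hηc v
  have h1 : ∀ x, lineDeriv ℝ η x (-v) * g x = -(fderiv ℝ η x v * g x) := fun x => by
    rw [(hη1.differentiable one_ne_zero x).lineDeriv_eq_fderiv, map_neg, neg_mul]
  simp only [h1, integral_neg] at h
  rw [eq_neg_iff_add_eq_zero, add_comm, ← eq_neg_iff_add_eq_zero, ← h]
  refine integral_congr_ae ?_
  filter_upwards [hg.ae_differentiableAt (μ := m)] with x hx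
  rw [hx.lineDeriv_eq_fderiv, mul_comm]
  congr 1
  simp [gradient]

omit [MeasurableSpace E] [BorelSpace E] in
theorem enorm_gradient (g : E → ℝ) (x : E) : ‖gradient g x‖ₑ = ‖fderiv ℝ g x‖ₑ := by
  rw [gradient, ← ofReal_norm, LinearIsometryEquiv.norm_map, ofReal_norm]

theorem measurable_gradient (g : E → ℝ) : Measurable (gradient g) :=
  (InnerProductSpace.toDual ℝ E).symm.continuous.measurable.comp (measurable_fderiv ℝ g)

theorem hasWeakGradient_of_differentiable {w : E → ℝ} (hw : Continuous w) (hw0 : ∀ x, 0 < w x)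
    {g : E → ℝ} (hg : Differentiable ℝ g)
    (hE : ∫⁻ x, ‖gradient g x‖ₑ ^ 2 ∂(m.withDensity fun x => ENNReal.ofReal (w x)) ≠ ⊤) :
    HasWeakGradient m g (gradient g) := by
  intro η hη hηc v
  have hη1 : ContDiff ℝ 1 η := hη.of_le (by exact_mod_cast le_top)
  have hηd : Differentiable ℝ η := hη1.differentiable one_ne_zero
  have hi : ∀ x, inner ℝ (gradient g x) v = fderiv ℝ g x v := fun x => by simp [gradient]
  simp only [hi]
  have hηi : Integrable η m := hη1.continuous.integrable_of_hasCompactSupport hηc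
  have hgc := hg.continuous
  refine neg_eq_iff_eq_neg.1 (Eq.symm <|
    integral_mul_fderiv_eq_neg_fderiv_mul_of_integrable ?_ ?_ ?_
    (fun x _ => hηd x) fun x _ => hg x)
  · have h1 : Continuous fun x => fderiv ℝ η x v :=
      (hη1.continuous_fderiv one_ne_zero).clm_apply continuous_const
    refine (h1.mul hgc).integrable_of_hasCompactSupport (HasCompactSupport.mul_right ?_)
    exact hηc.fderiv_apply (𝕜 := ℝ) v
  · obtain ⟨B, hB⟩ := (hηc.mul_right (f' := fun x => (w x)⁻¹)).exists_bound_of_continuous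
      (hη1.continuous.mul (hw.inv₀ fun x => (hw0 x).ne'))
    have hB' : ∀ x, ‖η x‖ ≤ B * w x := fun x => by
      have := hB x
      rw [Pi.mul_apply, norm_mul, norm_inv, Real.norm_of_nonneg (hw0 x).le,
        mul_inv_le_iff₀ (hw0 x)] at this
      exact this
    have hwi : Integrable (fun x => w x * ‖gradient g x‖ ^ 2) m := by
      refine ⟨(hw.measurable.mul ((measurable_gradient g).norm.pow_const 2)).aestronglyMeasurable,
        ?_⟩
      rw [lintegral_withDensity_eq_lintegral_mul_non_measurable _ (by fun_prop) (by simp)] at hE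
      refine lt_top_iff_ne_top.2 (ne_of_eq_of_ne (lintegral_congr fun x => ?_) hE)
      rw [enorm_mul, enorm_pow, enorm_norm, Pi.mul_apply, ← ofReal_norm (w x),
        Real.norm_of_nonneg (hw0 x).le]
    refine ((hηi.norm.add (hwi.const_mul B)).mul_const ‖v‖).mono'
      (hη1.continuous.measurable.mul (measurable_fderiv_apply_const ℝ g v)).aestronglyMeasurable
      (Eventually.of_forall fun x => ?_)
    have h2 : ‖fderiv ℝ g x v‖ ≤ ‖gradient g x‖ * ‖v‖ := by
      rw [← hi]; exact norm_inner_le_norm _ _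
    have h3 : ‖gradient g x‖ ≤ 1 + ‖gradient g x‖ ^ 2 := by
      nlinarith [sq_nonneg (‖gradient g x‖ - 1), norm_nonneg (gradient g x)]
    calc ‖η x * fderiv ℝ g x v‖ = ‖η x‖ * ‖fderiv ℝ g x v‖ := norm_mul _ _
      _ ≤ ‖η x‖ * ((1 + ‖gradient g x‖ ^ 2) * ‖v‖) := by
          gcongr; exact h2.trans (by gcongr)
      _ = (‖η x‖ + ‖η x‖ * ‖gradient g x‖ ^ 2) * ‖v‖ := by ring
      _ ≤ (‖η x‖ + B * w x * ‖gradient g x‖ ^ 2) * ‖v‖ := by gcongr; exact hB' x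
      _ = _ := by simp only [Pi.add_apply]; ring
  · exact (hη1.continuous.mul hgc).integrable_of_hasCompactSupport hηc.mul_right

end PowerLogSobolev

section HopfLax

open Filter Topology

variable {E : Type*} [NormedAddCommGroup E]

/-- The Hopf–Lax (inf-convolution) operator. -/
noncomputable def hopfLax (φ : E → ℝ) (t : ℝ) (x : E) : ℝ :=
  ⨅ y, (φ y + ‖x - y‖ ^ 2 / (2 * t))

variable {φ : E → ℝ} {M : ℝ}

theorem neg_le_hopfLax_arg (hM : ∀ x, |φ x| ≤ M) {t : ℝ} (ht : 0 < t) (x y : E) :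
    -M ≤ φ y + ‖x - y‖ ^ 2 / (2 * t) := by
  have h1 := (abs_le.1 (hM y)).1
  have : 0 ≤ ‖x - y‖ ^ 2 / (2 * t) := by positivity
  linarith

theorem hopfLax_le (hM : ∀ x, |φ x| ≤ M) {t : ℝ} (ht : 0 < t) (x y : E) :
    hopfLax φ t x ≤ φ y + ‖x - y‖ ^ 2 / (2 * t) :=
  ciInf_le ⟨-M, by rintro _ ⟨y, rfl⟩; exact neg_le_hopfLax_arg hM ht x y⟩ y

theorem hopfLax_le_self (hM : ∀ x, |φ x| ≤ M) {t : ℝ} (ht : 0 < t) (x : E) :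
    hopfLax φ t x ≤ φ x := by
  simpa using hopfLax_le hM ht x x

theorem abs_hopfLax_le (hM : ∀ x, |φ x| ≤ M) {t : ℝ} (ht : 0 < t) (x : E) :
    |hopfLax φ t x| ≤ M :=
  abs_le.2 ⟨le_ciInf fun y => neg_le_hopfLax_arg hM ht x y,
    (hopfLax_le_self hM ht x).trans (abs_le.1 (hM x)).2⟩

theorem hopfLax_add_le (hM : ∀ x, |φ x| ≤ M) {t h : ℝ} (ht : 0 < t) (hh : 0 < h) (x y : E) :
    hopfLax φ (t + h) x ≤ hopfLax φ t y + ‖x - y‖ ^ 2 / (2 * h) := by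
  rw [← sub_le_iff_le_add]
  refine le_ciInf fun z => ?_
  have h1 := hopfLax_le hM (add_pos ht hh) x z
  have h2 : ‖x - z‖ ≤ ‖x - y‖ + ‖y - z‖ := norm_sub_le_norm_sub_add_norm_sub x y z
  have h3 : ‖x - z‖ ^ 2 / (2 * (t + h)) ≤ ‖y - z‖ ^ 2 / (2 * t) + ‖x - y‖ ^ 2 / (2 * h) := by
    calc ‖x - z‖ ^ 2 / (2 * (t + h)) ≤ (‖x - y‖ + ‖y - z‖) ^ 2 / (2 * (t + h)) := by gcongr
      _ ≤ _ := by
        rw [div_add_div _ _ (by positivity) (by positivity), div_le_div_iff₀ (by positivity)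
          (by positivity)]
        nlinarith [sq_nonneg (t * ‖x - y‖ - h * ‖y - z‖)]
  linarith

theorem le_hopfLax_arg_of_lt (hM : ∀ x, |φ x| ≤ M) {t : ℝ} (ht : 0 < t) {x y : E}
    (h : 4 * M * t < ‖x - y‖ ^ 2) : M ≤ φ y + ‖x - y‖ ^ 2 / (2 * t) := by
  have h1 := (abs_le.1 (hM y)).1
  have : 2 * M ≤ ‖x - y‖ ^ 2 / (2 * t) := by
    rw [le_div_iff₀ (by positivity)]; linarith
  linarith

theorem exists_lipschitzWith_hopfLax (hM : ∀ x, |φ x| ≤ M) {t : ℝ} (ht : 0 < t) :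
    ∃ K, LipschitzWith K (hopfLax φ t) := by
  have hM0 : 0 ≤ M := (abs_nonneg _).trans (hM 0)
  refine ⟨_, LipschitzWith.of_le_add_mul
    (2 * M + (1 + 2 * √(4 * M * t)) / (2 * t)).toNNReal fun x' x => ?_⟩
  rw [← sub_le_iff_le_add, Real.coe_toNNReal _ (by positivity)]
  refine le_ciInf fun y => ?_
  have hK : 0 ≤ (1 + 2 * √(4 * M * t)) / (2 * t) := by positivity
  have hx' := (abs_le.1 (abs_hopfLax_le hM ht x')).2
  have hd : 0 ≤ dist x' x := dist_nonneg
  rcases lt_or_ge (4 * M * t) (‖x - y‖ ^ 2) with h | h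
  · have := le_hopfLax_arg_of_lt hM ht h
    nlinarith [mul_nonneg hM0 hd, mul_nonneg hK hd]
  rcases le_total (dist x' x) 1 with h1 | h1
  · have h2 := hopfLax_le hM ht x' y
    have h3 : ‖x - y‖ ≤ √(4 * M * t) := Real.le_sqrt_of_sq_le h
    have h4 : ‖x' - y‖ ≤ dist x' x + ‖x - y‖ := by
      rw [dist_eq_norm]; exact norm_sub_le_norm_sub_add_norm_sub _ _ _
    have h5 : ‖x' - y‖ ^ 2 / (2 * t) ≤ ‖x - y‖ ^ 2 / (2 * t) +
        (1 + 2 * √(4 * M * t)) / (2 * t) * dist x' x := by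
      rw [div_mul_eq_mul_div, ← add_div]
      gcongr
      have h6 : ‖x' - y‖ ^ 2 ≤ (dist x' x + ‖x - y‖) ^ 2 := by gcongr
      nlinarith [mul_le_mul_of_nonneg_left h3 hd, mul_le_mul_of_nonneg_left h1 hd]
    nlinarith [mul_nonneg hM0 hd]
  · have := neg_le_hopfLax_arg hM ht x y
    nlinarith [mul_le_mul_of_nonneg_left h1 hM0, mul_nonneg hK hd]

theorem hopfLax_le_hopfLax_add (hM : ∀ x, |φ x| ≤ M) {s t : ℝ} (hs : 0 < s) (ht : 0 < t) (x : E) :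
    hopfLax φ s x ≤ hopfLax φ t x + 2 * M * t * |s⁻¹ - t⁻¹| := by
  have hM0 : 0 ≤ M := (abs_nonneg _).trans (hM 0)
  rw [← sub_le_iff_le_add]
  refine le_ciInf fun y => ?_
  have h0 : 0 ≤ 2 * M * t * |s⁻¹ - t⁻¹| := by positivity
  rcases lt_or_ge (4 * M * t) (‖x - y‖ ^ 2) with h | h
  · have := le_hopfLax_arg_of_lt hM ht h
    linarith [(abs_le.1 (abs_hopfLax_le hM hs x)).2]
  · have h1 := hopfLax_le hM hs x y
    have h2 : ‖x - y‖ ^ 2 / (2 * s) = ‖x - y‖ ^ 2 / (2 * t) +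
        ‖x - y‖ ^ 2 / 2 * (s⁻¹ - t⁻¹) := by
      field_simp; ring
    have h3 : ‖x - y‖ ^ 2 / 2 * (s⁻¹ - t⁻¹) ≤ 2 * M * t * |s⁻¹ - t⁻¹| := by
      calc _ ≤ ‖x - y‖ ^ 2 / 2 * |s⁻¹ - t⁻¹| := by gcongr; exact le_abs_self _
        _ ≤ _ := by gcongr; linarith
    linarith

theorem continuousAt_hopfLax (hM : ∀ x, |φ x| ≤ M) {t : ℝ} (ht : 0 < t) (x : E) :
    ContinuousAt (fun s => hopfLax φ s x) t := by
  have hc : ContinuousAt (fun s : ℝ => s⁻¹) t := continuousAt_inv₀ ht.ne'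
  have h1 : Tendsto (fun s : ℝ => 2 * M * (s + t) * |s⁻¹ - t⁻¹|) (𝓝 t) (𝓝 0) := by
    have : ContinuousAt (fun s : ℝ => 2 * M * (s + t) * |s⁻¹ - t⁻¹|) t := by fun_prop
    simpa [ContinuousAt] using this
  have hM0 : 0 ≤ M := (abs_nonneg _).trans (hM 0)
  refine tendsto_iff_dist_tendsto_zero.2 (squeeze_zero' (Eventually.of_forall fun _ => dist_nonneg)
    ?_ h1)
  filter_upwards [lt_mem_nhds ht] with s hs
  have h2 := hopfLax_le_hopfLax_add hM hs ht x
  have h3 := hopfLax_le_hopfLax_add hM ht hs x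
  rw [abs_sub_comm] at h3
  have h4 : 0 ≤ 2 * M * t * |s⁻¹ - t⁻¹| := by positivity
  have h5 : 0 ≤ 2 * M * s * |s⁻¹ - t⁻¹| := by positivity
  rw [Real.dist_eq, abs_le]
  constructor <;> nlinarith

end HopfLax

section HamiltonJacobi

open Filter Topology

theorem Real.abs_exp_sub_exp_le {a b B : ℝ} (ha : a ≤ B) (hb : b ≤ B) :
    |Real.exp a - Real.exp b| ≤ Real.exp B * |a - b| := by
  have key : ∀ a b : ℝ, a ≤ B → Real.exp a - Real.exp b ≤ Real.exp B * |a - b| := by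
    intro a b ha
    have h1 := mul_le_mul_of_nonneg_left (Real.add_one_le_exp (b - a)) (Real.exp_pos a).le
    rw [← Real.exp_add, add_sub_cancel] at h1
    have h2 : Real.exp a * (a - b) ≤ Real.exp B * |a - b| :=
      (mul_le_mul_of_nonneg_left (le_abs_self _) (Real.exp_pos a).le).trans
        (mul_le_mul_of_nonneg_right (Real.exp_le_exp.2 ha) (abs_nonneg _))
    linarith
  rw [abs_le]
  constructor
  · have := key b a hb
    rw [abs_sub_comm] at this
    linarith
  · exact key a b ha

theorem hasDerivAt_integral_exp {α : Type*} [MeasurableSpace α] {μ : Measure α} [IsFiniteMeasure μ]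
    {A : ℝ → α → ℝ} {A' : α → ℝ} {t B L : ℝ} (hAm : ∀ s, AEStronglyMeasurable (A s) μ)
    (hB : ∀ᶠ s in 𝓝 t, ∀ x, |A s x| ≤ B)
    (hL : ∀ᶠ s in 𝓝 t, ∀ x, |A s x - A t x| ≤ L * |s - t|)
    (hd : ∀ᵐ x ∂μ, HasDerivAt (fun s => A s x) (A' x) t) :
    HasDerivAt (fun s => ∫ x, Real.exp (A s x) ∂μ) (∫ x, Real.exp (A t x) * A' x ∂μ) t := by
  have hm : ∀ s, AEStronglyMeasurable (fun x => Real.exp (A s x)) μ := fun s =>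
    Real.continuous_exp.comp_aestronglyMeasurable (hAm s)
  have hi : ∀ᶠ s in 𝓝 t, Integrable (fun x => Real.exp (A s x)) μ := by
    filter_upwards [hB] with s hs
    refine .of_bound (hm s) (Real.exp B) (Eventually.of_forall fun x => ?_)
    rw [Real.norm_of_nonneg (Real.exp_pos _).le]
    exact Real.exp_le_exp.2 ((le_abs_self _).trans (hs x))
  rw [hasDerivAt_iff_tendsto_slope]
  have h1 : Tendsto (fun s => ∫ x, slope (fun s => Real.exp (A s x)) t s ∂μ) (𝓝[≠] t)
      (𝓝 (∫ x, Real.exp (A t x) * A' x ∂μ)) := by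
    refine tendsto_integral_filter_of_dominated_convergence (fun _ => Real.exp B * L)
      (Eventually.of_forall fun s => ?_) ?_ (integrable_const _) ?_
    · simp only [slope_def_field, div_eq_mul_inv]
      exact ((hm s).sub (hm t)).mul_const _
    · filter_upwards [nhdsWithin_le_nhds hB, nhdsWithin_le_nhds hL, self_mem_nhdsWithin]
        with s hs1 hs2 hst
      refine Eventually.of_forall fun x => ?_
      rw [slope_def_field, norm_div, Real.norm_eq_abs, Real.norm_eq_abs,
        div_le_iff₀ (abs_pos.2 (sub_ne_zero.2 hst)), mul_assoc]
      refine (Real.abs_exp_sub_exp_le ((le_abs_self _).trans (hs1 x))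
        ((le_abs_self _).trans (hB.self_of_nhds x))).trans ?_
      gcongr
      exact hs2 x
    · filter_upwards [hd] with x hx
      exact hasDerivAt_iff_tendsto_slope.1 hx.exp
  refine h1.congr' ?_
  filter_upwards [nhdsWithin_le_nhds hi] with s hs
  simp only [slope_def_field]
  rw [integral_div, integral_sub hs hi.self_of_nhds]

theorem Real.mul_rpow_sub_one_mul_le {δ x y : ℝ} (hδ : 1 ≤ δ) (hx : 0 ≤ x) (hy : 0 ≤ y) :
    δ * y ^ (δ - 1) * x ≤ x ^ δ + (δ - 1) * y ^ δ := by
  have h0 : 0 < δ := by linarith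
  have h := Real.geom_mean_le_arith_mean2_weighted (w₁ := 1 / δ) (w₂ := 1 - 1 / δ) (by positivity)
    (by rw [sub_nonneg, div_le_one h0]; exact hδ) (Real.rpow_nonneg hx δ) (Real.rpow_nonneg hy δ)
    (by ring)
  rw [← Real.rpow_mul hx, ← Real.rpow_mul hy, mul_one_div_cancel h0.ne', Real.rpow_one,
    mul_sub, mul_one_div_cancel h0.ne', mul_one] at h
  have h2 := mul_le_mul_of_nonneg_left h h0.le
  calc _ = δ * (x * y ^ (δ - 1)) := by ring
    _ ≤ _ := h2
    _ = _ := by field_simp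

variable {E : Type*} [NormedAddCommGroup E] [InnerProductSpace ℝ E] [FiniteDimensional ℝ E]
  [MeasurableSpace E] [BorelSpace E] {m : Measure E} [m.IsAddHaarMeasure]

omit [MeasurableSpace E] [BorelSpace E] in
theorem norm_gradient_le_of_lipschitz {q : E → ℝ} {K : ℝ≥0} (hq : LipschitzWith K q) (x : E) :
    ‖gradient q x‖ ≤ K := by
  rw [gradient, LinearIsometryEquiv.norm_map]
  exact norm_fderiv_le_of_lipschitz ℝ hq

/-- Differentiation of exponential integrals along one explicit step of the Hamilton–Jacobi
equation. -/
theorem hasDerivAt_integral_exp_step {μ : Measure E} [IsFiniteMeasure μ] (hμ : μ ≪ m)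
    {q : E → ℝ} {K : ℝ≥0} (hq : LipschitzWith K q) {M : ℝ} (hM : ∀ x, |q x| ≤ M) {l : ℝ → ℝ}
    {l' t : ℝ} (hl : HasDerivAt l l' t) :
    HasDerivAt (fun s => ∫ x, Real.exp (l s * (q (x - (s - t) • gradient q x) +
        (s - t) * (‖gradient q x‖ ^ 2 / 2))) ∂μ)
      (∫ x, Real.exp (l t * q x) * (l' * q x - l t * (‖gradient q x‖ ^ 2 / 2)) ∂μ) t := by
  have hM0 : 0 ≤ M := (abs_nonneg _).trans (hM 0)
  have hp := measurable_gradient q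
  have hqm := hq.continuous.measurable
  have hpK : ∀ x, ‖gradient q x‖ ≤ K := norm_gradient_le_of_lipschitz hq
  have hl1 : ∀ᶠ s in 𝓝 t, |l s| ≤ |l t| + 1 :=
    hl.continuousAt.abs.eventually_le_const (lt_add_one _)
  have hl2 : ∀ᶠ s in 𝓝 t, |l s - l t| ≤ (|l'| + 1) * |s - t| := by
    have := hl.isLittleO.def one_pos
    filter_upwards [this] with s hs
    simp only [Real.norm_eq_abs, smul_eq_mul, one_mul] at hs
    have h1 := abs_add_le (l s - l t - (s - t) * l') ((s - t) * l')
    rw [sub_add_cancel, abs_mul] at h1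
    linarith
  have hs1 : ∀ᶠ s in 𝓝 t, |s - t| ≤ 1 := by
    have : ContinuousAt (fun s : ℝ => |s - t|) t := by fun_prop
    refine this.eventually_le_const ?_
    simp
  have hstep : ∀ s x, |(s - t) * (‖gradient q x‖ ^ 2 / 2)| ≤ |s - t| * (K ^ 2 / 2) := fun s x => by
    rw [abs_mul, abs_of_nonneg (by positivity : 0 ≤ ‖gradient q x‖ ^ 2 / 2)]
    gcongr
    exact hpK x
  have hqs : ∀ s x, |q (x - (s - t) • gradient q x) - q x| ≤ |s - t| * K ^ 2 := fun s x => by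
    rw [← Real.dist_eq]
    refine (hq.dist_le_mul _ _).trans ?_
    rw [dist_eq_norm, sub_sub_cancel_left, norm_neg, norm_smul, Real.norm_eq_abs]
    calc (K : ℝ) * (|s - t| * ‖gradient q x‖) ≤ K * (|s - t| * K) := by gcongr; exact hpK x
      _ = _ := by ring
  have key := hasDerivAt_integral_exp (μ := μ) (t := t) (A := fun s x => l s *
    (q (x - (s - t) • gradient q x) + (s - t) * (‖gradient q x‖ ^ 2 / 2)))
    (A' := fun x => l' * q x - l t * (‖gradient q x‖ ^ 2 / 2))
    (B := (|l t| + 1) * (M + K ^ 2 / 2))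
    (L := (|l'| + 1) * M + (|l t| + 1) * (K ^ 2 + K ^ 2 / 2))
    (fun s => by fun_prop) ?_ ?_ ?_
  · simpa using key
  · filter_upwards [hl1, hs1] with s h1 h2 x
    rw [abs_mul]
    refine mul_le_mul h1 ?_ (abs_nonneg _) (by positivity)
    refine (abs_add_le _ _).trans (add_le_add (hM _) ((hstep s x).trans ?_))
    exact mul_le_of_le_one_left (by positivity) h2
  · filter_upwards [hl1, hl2] with s h1 h2 x
    simp only [sub_self, zero_smul, sub_zero, zero_mul, add_zero]
    calc _ = |(l s - l t) * q x + l s * ((q (x - (s - t) • gradient q x) - q x) +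
          (s - t) * (‖gradient q x‖ ^ 2 / 2))| := by ring_nf
      _ ≤ |l s - l t| * |q x| + |l s| * (|q (x - (s - t) • gradient q x) - q x| +
          |(s - t) * (‖gradient q x‖ ^ 2 / 2)|) := by
        refine (abs_add_le _ _).trans ?_
        rw [abs_mul, abs_mul]
        gcongr
        exact abs_add_le _ _
      _ ≤ (|l'| + 1) * |s - t| * M + (|l t| + 1) * (|s - t| * K ^ 2 + |s - t| * (K ^ 2 / 2)) := by
        gcongr
        · exact hM x
        · exact hqs s x
        · exact hstep s x
      _ = _ := by ring
  · filter_upwards [hμ.ae_le (hq.ae_differentiableAt (μ := m))] with x hx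
    have h1 : HasDerivAt (fun s : ℝ => x - (s - t) • gradient q x) (-gradient q x) t := by
      simpa using (((hasDerivAt_id t).sub_const t).smul_const (gradient q x)).const_sub x
    have h2 : HasFDerivAt q (fderiv ℝ q x) (x - (t - t) • gradient q x) := by
      simpa using hx.hasFDerivAt
    have h3 := h2.comp_hasDerivAt t h1
    have h4 : fderiv ℝ q x (-gradient q x) = -‖gradient q x‖ ^ 2 := by
      rw [map_neg, ← real_inner_self_eq_norm_sq]
      congr 1
      rw [gradient, ← InnerProductSpace.toDual_apply_apply (𝕜 := ℝ),
        LinearIsometryEquiv.apply_symm_apply]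
    rw [h4] at h3
    have h5 := ((hasDerivAt_id t).sub_const t).mul_const (‖gradient q x‖ ^ 2 / 2)
    have h6 := hl.mul (h3.add h5)
    refine h6.congr_deriv ?_
    simp
    ring

variable {μ : Measure E} [IsProbabilityMeasure μ] {δ C : ℝ} {w : E → ℝ}

theorem PowerLogSobolev.rpow_entropy_le (hL : PowerLogSobolev μ δ C)
    (hδ : 0 ≤ δ) (hC : 0 ≤ C) (hw : Continuous w) (hw0 : ∀ x, 0 < w x)
    (hμ : μ = m.withDensity fun x => ENNReal.ofReal (w x))
    {g : E → ℝ} {G : E → E} (h : HasWeakGradient m g G) (hg : Measurable g) {M : ℝ}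
    (hM : ∀ x, |g x| ≤ M) (hG : AEMeasurable G m) (h1 : ∫ x, g x ^ 2 ∂μ = 1) {J : ℝ} (hJ0 : 0 ≤ J)
    (hJ : ∫⁻ x, ‖G x‖ₑ ^ 2 ∂μ ≤ ENNReal.ofReal J) :
    (∫ x, g x ^ 2 * Real.log (g x ^ 2) ∂μ) ^ δ ≤ C * J := by
  have := (hL.of_hasWeakGradient hδ hw hw0 hμ h hg hM hG h1).trans (mul_le_mul_right hJ _)
  rwa [← ENNReal.ofReal_mul hC, ENNReal.ofReal_le_ofReal_iff (by positivity)] at this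

omit [InnerProductSpace ℝ E] [FiniteDimensional ℝ E] [MeasurableSpace E] [BorelSpace E] in
theorem exists_lipschitzWith_exp_mul {q : E → ℝ} {K : ℝ≥0} (hq : LipschitzWith K q) {M : ℝ}
    (hM : ∀ x, |q x| ≤ M) (a c : ℝ) :
    ∃ K', LipschitzWith K' fun x => Real.exp (a * q x) * c := by
  refine ⟨_, LipschitzWith.of_dist_le_mul
    (K := (Real.exp (|a| * M) * |a| * K * |c|).toNNReal) fun x y => ?_⟩
  have hle : ∀ x, a * q x ≤ |a| * M := fun x => by
    refine (le_abs_self _).trans ?_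
    rw [abs_mul]
    gcongr
    exact hM x
  rw [Real.coe_toNNReal _ (by positivity), Real.dist_eq, ← sub_mul, abs_mul]
  calc _ ≤ Real.exp (|a| * M) * |a * q x - a * q y| * |c| := by
        gcongr; exact Real.abs_exp_sub_exp_le (hle x) (hle y)
    _ = Real.exp (|a| * M) * (|a| * dist (q x) (q y)) * |c| := by
        rw [← mul_sub, abs_mul, Real.dist_eq]
    _ ≤ Real.exp (|a| * M) * (|a| * (K * dist x y)) * |c| := by
        gcongr; exact hq.dist_le_mul x y
    _ = _ := by ring

theorem PowerLogSobolev.deriv_log_integral_exp_le (hL : PowerLogSobolev μ δ C)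
    (hδ : 1 ≤ δ) (hC : 0 < C) (hw : Continuous w) (hw0 : ∀ x, 0 < w x)
    (hμ : μ = m.withDensity fun x => ENNReal.ofReal (w x)) {q : E → ℝ} {K : ℝ≥0}
    (hq : LipschitzWith K q) {M : ℝ} (hM : ∀ x, |q x| ≤ M) {a l' e : ℝ} (ha : 0 < a) (he : 0 ≤ e)
    (hl' : l' = 2 / C * (δ * e ^ (δ - 1))) :
    ((∫ x, Real.exp (a * q x) * (l' * q x - a * (‖gradient q x‖ ^ 2 / 2)) ∂μ) /
        (∫ x, Real.exp (a * q x) ∂μ) * a - Real.log (∫ x, Real.exp (a * q x) ∂μ) * l') / a ^ 2 ≤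
      2 / C * ((δ - 1) * e ^ δ) / a ^ 2 := by
  have hac : μ ≪ m := hμ ▸ withDensity_absolutelyContinuous _ _
  have hqm := hq.continuous.measurable
  have hp := measurable_gradient q
  have hpK : ∀ x, ‖gradient q x‖ ≤ K := norm_gradient_le_of_lipschitz hq
  have hexpM : ∀ x, Real.exp (a * q x) ≤ Real.exp (a * M) := fun x => by
    gcongr; exact (abs_le.1 (hM x)).2
  have hei : Integrable (fun x => Real.exp (a * q x)) μ :=
    .of_bound (by fun_prop) (Real.exp (a * M)) (Eventually.of_forall fun x => by
      rw [Real.norm_of_nonneg (Real.exp_pos _).le]; exact hexpM x)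
  set Z := ∫ x, Real.exp (a * q x) ∂μ with hZ
  have hZ0 : 0 < Z := integral_exp_pos hei
  have hqi : Integrable (fun x => Real.exp (a * q x) * q x) μ :=
    hei.mul_bdd (c := M) hqm.aestronglyMeasurable (Eventually.of_forall hM)
  have hpi : Integrable (fun x => Real.exp (a * q x) * ‖gradient q x‖ ^ 2) μ := by
    refine hei.mul_bdd (c := (K : ℝ) ^ 2) (by fun_prop) (Eventually.of_forall fun x => ?_)
    rw [Real.norm_of_nonneg (by positivity)]
    gcongr
    exact hpK x
  set X := ∫ x, Real.exp (a * q x) * q x ∂μ with hX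
  set A := ∫ x, Real.exp (a * q x) * ‖gradient q x‖ ^ 2 ∂μ with hA
  have hA0 : 0 ≤ A := integral_nonneg fun x => by positivity
  have hint : ∫ x, Real.exp (a * q x) * (l' * q x - a * (‖gradient q x‖ ^ 2 / 2)) ∂μ =
      l' * X - a / 2 * A := by
    rw [hX, hA, ← integral_const_mul, ← integral_const_mul, ← integral_sub (hqi.const_mul _)
      (hpi.const_mul _)]
    congr 1 with x
    ring
  set u : E → ℝ := fun x => Real.exp (a / 2 * q x) * (√Z)⁻¹ with hu
  obtain ⟨K', huK⟩ := exists_lipschitzWith_exp_mul hq hM (a / 2) (√Z)⁻¹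
  have husq : ∀ x, u x ^ 2 = Real.exp (a * q x) / Z := fun x => by
    rw [hu, mul_pow, inv_pow, Real.sq_sqrt hZ0.le, ← Real.exp_nat_mul, div_eq_mul_inv]
    congr 2
    push_cast
    ring
  have hu1 : ∫ x, u x ^ 2 ∂μ = 1 := by
    simp only [husq]
    rw [integral_div, div_self hZ0.ne']
  have huM : ∀ x, |u x| ≤ Real.exp (a / 2 * M) * (√Z)⁻¹ := fun x => by
    rw [abs_of_nonneg (by positivity)]
    have := (abs_le.1 (hM x)).2
    simp only [hu]
    gcongr
  have hent : ∫ x, u x ^ 2 * Real.log (u x ^ 2) ∂μ = a * (X / Z) - Real.log Z := by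
    have h1 : ∀ x, u x ^ 2 * Real.log (u x ^ 2) =
        a / Z * (Real.exp (a * q x) * q x) - Real.log Z / Z * Real.exp (a * q x) := fun x => by
      rw [husq, Real.log_div (Real.exp_pos _).ne' hZ0.ne', Real.log_exp]
      ring
    simp only [h1]
    rw [integral_sub (hqi.const_mul _) (hei.const_mul _), integral_const_mul, integral_const_mul,
      ← hX, ← hZ, div_mul_cancel₀ _ hZ0.ne']
    ring
  have hgrad : ∫⁻ x, ‖gradient u x‖ₑ ^ 2 ∂μ ≤ ENNReal.ofReal (a ^ 2 / 4 * (A / Z)) := by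
    rw [hA, ← integral_div, ← integral_const_mul, ofReal_integral_eq_lintegral_ofReal
      ((hpi.div_const _).const_mul _) (Eventually.of_forall fun x => by positivity)]
    refine (lintegral_congr_ae ?_).le
    filter_upwards [hac.ae_le (hq.ae_differentiableAt (μ := m))] with x hx
    have h1 : fderiv ℝ u x = (u x * (a / 2)) • fderiv ℝ q x := by
      have := ((hx.hasFDerivAt.const_mul (a / 2)).exp.mul_const (√Z)⁻¹).fderiv
      rw [this, smul_smul, smul_smul]
      congr 1
      simp only [hu]
      ring
    rw [enorm_gradient, h1, enorm_smul, ← enorm_gradient, ← ofReal_norm, ← ofReal_norm,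
      ← ENNReal.ofReal_mul (norm_nonneg _), ← ENNReal.ofReal_pow (by positivity)]
    congr 1
    rw [mul_pow, norm_mul, mul_pow, Real.norm_eq_abs, sq_abs, husq, Real.norm_eq_abs, sq_abs]
    ring
  have hls := hL.rpow_entropy_le (by linarith) hC.le hw hw0 hμ
    (hasWeakGradient_of_lipschitzWith huK) huK.continuous.measurable huM
    (measurable_gradient _).aemeasurable hu1 (by positivity) hgrad
  rw [hent] at hls
  have hl0 : 0 ≤ l' := by rw [hl']; positivity
  rw [hint]
  refine (div_le_div_iff_of_pos_right (by positivity)).2 ?_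
  set Ent := a * (X / Z) - Real.log Z with hEnt
  have e1 : (l' * X - a / 2 * A) / Z * a - Real.log Z * l' =
      l' * Ent - a ^ 2 / 2 * (A / Z) := by rw [hEnt]; ring
  rw [e1]
  have hAZ : 0 ≤ A / Z := by positivity
  have hr : 0 ≤ 2 / C * ((δ - 1) * e ^ δ) := by
    have : 0 ≤ δ - 1 := by linarith
    positivity
  rcases lt_or_ge Ent 0 with h | h
  · have h2 : 0 ≤ a ^ 2 / 2 * (A / Z) := by positivity
    nlinarith
  · have h1 := Real.mul_rpow_sub_one_mul_le hδ h he
    have h2 : 2 / C * Ent ^ δ ≤ a ^ 2 / 2 * (A / Z) := by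
      rw [div_mul_eq_mul_div, div_le_iff₀ hC]; linarith
    have h3 := mul_le_mul_of_nonneg_left h1 (by positivity : 0 ≤ 2 / C)
    rw [hl']
    nlinarith

theorem integrable_exp_mul {α : Type*} [MeasurableSpace α] {μ : Measure α} [IsFiniteMeasure μ]
    {q : α → ℝ} (hq : Measurable q) {M : ℝ} (hM : ∀ x, |q x| ≤ M) {a : ℝ}
    (ha : 0 ≤ a) : Integrable (fun x => Real.exp (a * q x)) μ :=
  .of_bound (by fun_prop) (Real.exp (a * M)) (Eventually.of_forall fun x => by
    rw [Real.norm_of_nonneg (Real.exp_pos _).le]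
    gcongr
    exact (abs_le.1 (hM x)).2)

omit [InnerProductSpace ℝ E] [FiniteDimensional ℝ E] [MeasurableSpace E] [BorelSpace E] in
theorem continuous_hopfLax {φ : E → ℝ} {M : ℝ} (hM : ∀ x, |φ x| ≤ M) {t : ℝ} (ht : 0 < t) :
    Continuous (hopfLax φ t) :=
  (exists_lipschitzWith_hopfLax hM ht).choose_spec.continuous

theorem PowerLogSobolev.eventually_slope_lt (hL : PowerLogSobolev μ δ C)
    (hδ : 1 ≤ δ) (hC : 0 < C) (hw : Continuous w) (hw0 : ∀ x, 0 < w x)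
    (hμ : μ = m.withDensity fun x => ENNReal.ofReal (w x)) {φ : E → ℝ} {M : ℝ}
    (hM : ∀ x, |φ x| ≤ M) {l : ℝ → ℝ} {l' t e r : ℝ} (ht : 0 < t) (hl0 : ∀ s, 0 < s → 0 < l s)
    (hl : HasDerivAt l l' t) (he : 0 ≤ e) (hl' : l' = 2 / C * (δ * e ^ (δ - 1)))
    (hr : 2 / C * ((δ - 1) * e ^ δ) / l t ^ 2 < r) :
    ∀ᶠ s in 𝓝[>] t,
      slope (fun s => Real.log (∫ x, Real.exp (l s * hopfLax φ s x) ∂μ) / l s) t s < r := by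
  have hac : μ ≪ m := hμ ▸ withDensity_absolutelyContinuous _ _
  obtain ⟨K, hK⟩ := exists_lipschitzWith_hopfLax hM ht
  have hq := abs_hopfLax_le hM ht
  have hqm := hK.continuous.measurable
  have hp := measurable_gradient (hopfLax φ t)
  have hpK : ∀ x, ‖gradient (hopfLax φ t) x‖ ≤ K := norm_gradient_le_of_lipschitz hK
  have h0 : (∫ x, Real.exp (l t * hopfLax φ t x) ∂μ) ≠ 0 :=
    (integral_exp_pos (integrable_exp_mul hqm hq (hl0 t ht).le)).ne'
  have hstep := hasDerivAt_integral_exp_step hac hK hq hl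
  have hd := (hstep.log (by simpa using h0)).div hl (hl0 t ht).ne'
  have hle := hL.deriv_log_integral_exp_le hδ hC hw hw0 hμ hK hq (hl0 t ht) he hl'
  simp only [sub_self, zero_smul, sub_zero, zero_mul, add_zero] at hd
  have hslope := hasDerivAt_iff_tendsto_slope.1 hd
  have hev :=
    (hslope.mono_left (nhdsWithin_mono t fun s (hs : t < s) => hs.ne')).eventually_lt_const
    (hle.trans_lt hr)
  filter_upwards [hev, self_mem_nhdsWithin] with s hs hst
  have hst : t < s := hst
  have hs0 := ht.trans hst
  refine lt_of_le_of_lt ?_ hs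
  rw [slope_def_field, slope_def_field]
  simp only [Pi.div_apply, sub_self, zero_smul, sub_zero, zero_mul, add_zero]
  refine (div_le_div_iff_of_pos_right (sub_pos.2 hst)).2 (sub_le_sub_right ?_ _)
  refine (div_le_div_iff_of_pos_right (hl0 s hs0)).2 ?_
  have hi := integrable_exp_mul (μ := μ) (continuous_hopfLax hM hs0).measurable
    (abs_hopfLax_le hM hs0) (hl0 s hs0).le
  refine Real.log_le_log (integral_exp_pos hi) (integral_mono hi (integrable_exp_mul (M :=
    M + (s - t) * (K ^ 2 / 2)) (by fun_prop) (fun x => ?_) (hl0 s hs0).le) fun x => ?_)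
  · refine (abs_add_le _ _).trans (add_le_add (hq _) ?_)
    have : 0 ≤ s - t := sub_nonneg.2 hst.le
    rw [abs_of_nonneg (by positivity)]
    gcongr
    exact hpK x
  · have h1 := hopfLax_add_le hM ht (sub_pos.2 hst) x
      (x - (s - t) • gradient (hopfLax φ t) x)
    rw [add_sub_cancel, _root_.sub_sub_cancel, norm_smul,
      Real.norm_of_nonneg (sub_nonneg.2 hst.le)] at h1
    have h2 : ((s - t) * ‖gradient (hopfLax φ t) x‖) ^ 2 / (2 * (s - t)) =
        (s - t) * (‖gradient (hopfLax φ t) x‖ ^ 2 / 2) := by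
      have := (sub_pos.2 hst).ne'
      field_simp
    rw [h2] at h1
    have := (hl0 s hs0).le
    dsimp only
    gcongr

omit [InnerProductSpace ℝ E] [FiniteDimensional ℝ E] in
theorem continuousAt_log_integral_exp_hopfLax {φ : E → ℝ} {M : ℝ}
    (hM : ∀ x, |φ x| ≤ M) {l : ℝ → ℝ} {t : ℝ} (ht : 0 < t) (hl0 : ∀ s, 0 < s → 0 < l s)
    (hl : ContinuousAt l t) :
    ContinuousAt (fun s => Real.log (∫ x, Real.exp (l s * hopfLax φ s x) ∂μ) / l s) t := by
  have h0 : (∫ x, Real.exp (l t * hopfLax φ t x) ∂μ) ≠ 0 :=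
    (integral_exp_pos (integrable_exp_mul (continuous_hopfLax hM ht).measurable
      (abs_hopfLax_le hM ht) (hl0 t ht).le)).ne'
  refine ContinuousAt.div (ContinuousAt.log ?_ h0) hl (hl0 t ht).ne'
  have hM0 : 0 ≤ M := (abs_nonneg _).trans (hM 0)
  refine tendsto_integral_filter_of_dominated_convergence (fun _ => Real.exp ((l t + 1) * M))
    ?_ ?_ (integrable_const _) (Eventually.of_forall fun x => ?_)
  · filter_upwards [lt_mem_nhds ht] with s hs
    have := (continuous_hopfLax hM hs).measurable
    fun_prop
  · filter_upwards [lt_mem_nhds ht, hl.eventually_le_const (lt_add_one _)] with s hs hls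
    refine Eventually.of_forall fun x => ?_
    rw [Real.norm_of_nonneg (Real.exp_pos _).le]
    have := (hl0 s hs).le
    refine Real.exp_le_exp.2 (mul_le_mul_of_nonneg_left ?_ this |>.trans
      (mul_le_mul_of_nonneg_right hls hM0))
    exact (abs_le.1 (abs_hopfLax_le hM hs x)).2
  · exact ((hl.mul (continuousAt_hopfLax hM ht x)).rexp)

theorem log_integral_exp_mul_div_le {α : Type*} [MeasurableSpace α] {μ : Measure α}
    [IsProbabilityMeasure μ] {φ : α → ℝ} (hφ : Measurable φ) {M : ℝ}
    (hM : ∀ x, |φ x| ≤ M) {a : ℝ} (ha : 0 < a) (haM : a * M ≤ 1) :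
    Real.log (∫ x, Real.exp (a * φ x) ∂μ) / a ≤ ∫ x, φ x ∂μ + a * M ^ 2 := by
  have hi := integrable_exp_mul (μ := μ) hφ hM ha.le
  have hφi : Integrable φ μ := .of_bound hφ.aestronglyMeasurable M (Eventually.of_forall hM)
  rw [div_le_iff₀ ha]
  refine (Real.log_le_sub_one_of_pos (integral_exp_pos hi)).trans ?_
  rw [sub_le_iff_le_add]
  calc ∫ x, Real.exp (a * φ x) ∂μ ≤ ∫ x, (a * φ x + (a ^ 2 * M ^ 2 + 1)) ∂μ := by
        refine integral_mono hi ((hφi.const_mul a).add (integrable_const _)) fun x => ?_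
        have h1 : |a * φ x| ≤ a * M := by
          rw [abs_mul, abs_of_pos ha]; gcongr; exact hM x
        have h2 := (abs_le.1 (Real.abs_exp_sub_one_sub_id_le (h1.trans haM))).2
        have h3 : (a * φ x) ^ 2 ≤ (a * M) ^ 2 := sq_le_sq' (abs_le.1 h1).1 (abs_le.1 h1).2
        dsimp only
        linarith
    _ = _ := by
        rw [integral_add (hφi.const_mul a) (integrable_const _), integral_const_mul]
        simp
        ring

theorem PowerLogSobolev.log_integral_exp_hopfLax_le (hL : PowerLogSobolev μ δ C)
    (hδ : 1 ≤ δ) (hδ2 : δ < 2) (hC : 0 < C) (hw : Continuous w) (hw0 : ∀ x, 0 < w x)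
    (hμ : μ = m.withDensity fun x => ENNReal.ofReal (w x)) {φ : E → ℝ} (hφ : Measurable φ) {M : ℝ}
    (hM : ∀ x, |φ x| ≤ M) {H Λ : ℝ} (hH : 0 < H) (hΛ : Λ = 2 / C * ((2 - δ) * H ^ (δ - 1))) :
    Real.log (∫ x, Real.exp (Λ * hopfLax φ 1 x) ∂μ) / Λ ≤
      ∫ x, φ x ∂μ + 2 / C * ((δ - 1) * H ^ δ) / Λ ^ 2 := by
  have h2 : 0 < 2 - δ := by linarith
  have hδ1 : 0 ≤ δ - 1 := by linarith
  have hΛ0 : 0 < Λ := by rw [hΛ]; positivity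
  set α := δ / (2 - δ) with hα
  have hα0 : 0 < α := by positivity
  set l : ℝ → ℝ := fun s => Λ * s ^ α with hl
  have hl0 : ∀ s, 0 < s → 0 < l s := fun s hs => by positivity
  have hld : ∀ s, 0 < s → HasDerivAt l (Λ * (α * s ^ (α - 1))) s := fun s hs =>
    (Real.hasDerivAt_rpow_const (.inl hs.ne')).const_mul Λ
  set κ := 2 / C * ((δ - 1) * H ^ δ) / Λ ^ 2 with hκ
  have hκ0 : 0 ≤ κ := by positivity
  set F : ℝ → ℝ := fun s => Real.log (∫ x, Real.exp (l s * hopfLax φ s x) ∂μ) / l s with hF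
  have hslope : ∀ t, 0 < t → ∀ r, κ < r → ∀ᶠ s in 𝓝[>] t, slope F t s < r := by
    intro t ht r hr
    refine hL.eventually_slope_lt hδ hC hw hw0 hμ hM ht hl0 (hld t ht)
      (e := H * t ^ (2 / (2 - δ))) (by positivity) ?_ ?_
    · rw [hΛ, Real.mul_rpow hH.le (by positivity), ← Real.rpow_mul ht.le,
        show α - 1 = 2 / (2 - δ) * (δ - 1) by rw [hα]; field_simp; ring, hα]
      field_simp
    · refine lt_of_eq_of_lt ?_ hr
      rw [hκ, Real.mul_rpow hH.le (by positivity), ← Real.rpow_mul ht.le, mul_pow,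
        ← Real.rpow_mul_natCast ht.le, show α * ((2 : ℕ) : ℝ) = 2 / (2 - δ) * δ by
          rw [hα]; push_cast; ring]
      have := (Real.rpow_pos_of_pos ht (2 / (2 - δ) * δ)).ne'
      field_simp
  have hmain : ∀ t, 0 < t → t ≤ 1 → F 1 ≤ F t + κ * (1 - t) := by
    intro t ht ht1
    refine image_le_of_liminf_slope_right_le_deriv_boundary (f := F) (a := t) (b := 1)
      (B := fun s => F t + κ * (s - t)) (B' := fun _ => κ) ?_ (by simp) (by fun_prop) ?_ ?_
      ⟨ht1, le_rfl⟩
    · intro s hs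
      have hs0 := ht.trans_le hs.1
      exact (continuousAt_log_integral_exp_hopfLax hM hs0 hl0
        (hld s hs0).continuousAt).continuousWithinAt
    · intro s _
      simpa using ((((hasDerivAt_id s).sub_const t).const_mul κ).const_add (F t)).hasDerivWithinAt
    · intro s hs r hr
      exact (hslope s (ht.trans_le hs.1) r hr).frequently
  have hlt : Tendsto l (𝓝[>] 0) (𝓝 0) := by
    have : ContinuousAt l 0 := by
      refine continuousAt_const.mul ?_
      exact Real.continuousAt_rpow_const _ _ (.inr hα0.le)
    have h := this.tendsto
    simp only [hl, Real.zero_rpow hα0.ne', mul_zero] at h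
    exact h.mono_left nhdsWithin_le_nhds
  have hlim : Tendsto (fun t => ∫ x, φ x ∂μ + l t * M ^ 2 + κ) (𝓝[>] 0)
      (𝓝 (∫ x, φ x ∂μ + 0 * M ^ 2 + κ)) := ((hlt.mul_const _).const_add _).add_const _
  have hF1 : Real.log (∫ x, Real.exp (Λ * hopfLax φ 1 x) ∂μ) / Λ = F 1 := by
    simp [hF, hl]
  rw [hF1]
  rw [zero_mul, add_zero] at hlim
  refine ge_of_tendsto hlim ?_
  have h5 : ∀ᶠ t in 𝓝[>] (0 : ℝ), l t * M ≤ 1 := by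
    have := hlt.mul_const M
    rw [zero_mul] at this
    exact this.eventually_le_const one_pos
  filter_upwards [self_mem_nhdsWithin, Ioo_mem_nhdsGT one_pos, h5] with t ht ht1 htM
  have ht : 0 < t := ht
  refine (hmain t ht ht1.2.le).trans ?_
  have h6 : F t ≤ ∫ x, φ x ∂μ + l t * M ^ 2 := by
    refine le_trans ?_ (log_integral_exp_mul_div_le hφ hM (hl0 t ht) htM)
    refine (div_le_div_iff_of_pos_right (hl0 t ht)).2 ?_
    have hi := integrable_exp_mul (μ := μ) (continuous_hopfLax hM ht).measurable
      (abs_hopfLax_le hM ht) (hl0 t ht).le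
    refine Real.log_le_log (integral_exp_pos hi) (integral_mono hi
      (integrable_exp_mul hφ hM (hl0 t ht).le) fun x => ?_)
    exact Real.exp_le_exp.2 (mul_le_mul_of_nonneg_left (hopfLax_le_self hM ht x) (hl0 t ht).le)
  nlinarith

end HamiltonJacobi

section TransportDual

open Filter Topology

theorem Real.mul_le_mul_log_sub_add_exp {a : ℝ} (ha : 0 ≤ a) (b : ℝ) :
    a * b ≤ a * Real.log a - a + Real.exp b := by
  rcases ha.eq_or_lt with rfl | ha
  · simpa using (Real.exp_pos b).le
  · have h := mul_le_mul_of_nonneg_left (Real.add_one_le_exp (b - Real.log a)) ha.le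
    rw [Real.exp_sub, Real.exp_log ha, mul_div_cancel₀ _ ha.ne'] at h
    linarith

theorem integral_mul_le_entropy_add_log {α : Type*} [MeasurableSpace α] {μ : Measure α}
    {f h : α → ℝ}
    (hf0 : ∀ x, 0 ≤ f x) (hf : Integrable f μ) (hfl : Integrable (fun x => f x * Real.log (f x)) μ)
    (hf1 : ∫ x, f x ∂μ = 1) (he : Integrable (fun x => Real.exp (h x)) μ)
    (hfh : Integrable (fun x => f x * h x) μ) (hZ : 0 < ∫ x, Real.exp (h x) ∂μ) :
    ∫ x, f x * h x ∂μ ≤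
      ∫ x, f x * Real.log (f x) ∂μ + Real.log (∫ x, Real.exp (h x) ∂μ) := by
  set Z := ∫ x, Real.exp (h x) ∂μ with hZd
  have h1 : ∫ x, (f x * h x - f x * Real.log Z) ∂μ ≤
      ∫ x, (f x * Real.log (f x) - f x + Real.exp (h x) / Z) ∂μ := by
    refine integral_mono (hfh.sub (hf.mul_const _)) ((hfl.sub hf).add (he.div_const _)) fun x => ?_
    have := Real.mul_le_mul_log_sub_add_exp (hf0 x) (h x - Real.log Z)
    rwa [Real.exp_sub, Real.exp_log hZ, mul_sub] at this
  have hs : Integrable (fun x => f x * Real.log (f x) - f x) μ := hfl.sub hf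
  rw [integral_sub hfh (hf.mul_const _), integral_mul_const, hf1,
    integral_add hs (he.div_const _), integral_sub hfl hf, hf1, integral_div, ← hZd,
    div_self hZ.ne'] at h1
  linarith

variable {E : Type*} [NormedAddCommGroup E] [InnerProductSpace ℝ E] [FiniteDimensional ℝ E]
  [MeasurableSpace E] [BorelSpace E] {m : Measure E} [m.IsAddHaarMeasure] {μ : Measure E}
  [IsProbabilityMeasure μ] {δ C : ℝ} {w : E → ℝ}

theorem PowerLogSobolev.integral_hopfLax_mul_le (hL : PowerLogSobolev μ δ C)
    (hδ : 1 ≤ δ) (hδ2 : δ < 2) (hC : 0 < C) (hw : Continuous w) (hw0 : ∀ x, 0 < w x)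
    (hμ : μ = m.withDensity fun x => ENNReal.ofReal (w x)) {g : E → ℝ} {G : E → E}
    (h : HasWeakGradient m g G) (hg : Measurable g) {B : ℝ}
    (hB : ∀ x, |g x| ≤ B) (hG : AEMeasurable G m) (h1 : ∫ x, g x ^ 2 ∂μ = 1) {J H : ℝ}
    (hJ0 : 0 ≤ J) (hJ : ∫⁻ x, ‖G x‖ₑ ^ 2 ∂μ ≤ ENNReal.ofReal J) (hH : 0 < H)
    (hJH : C * J ≤ H ^ δ) {φ : E → ℝ} (hφ : Measurable φ) {M : ℝ} (hM : ∀ x, |φ x| ≤ M) :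
    ∫ x, g x ^ 2 * hopfLax φ 1 x ∂μ ≤
      ∫ x, φ x ∂μ + C * H ^ (2 - δ) / (2 * (2 - δ) ^ 2) := by
  have h2 : 0 < 2 - δ := by linarith
  have hB0 : 0 ≤ B := (abs_nonneg _).trans (hB 0)
  have hent : ∫ x, g x ^ 2 * Real.log (g x ^ 2) ∂μ ≤ H := by
    by_contra! hlt
    have h3 := (hL.rpow_entropy_le (by linarith) hC.le hw hw0 hμ h hg hB hG h1 hJ0 hJ).trans hJH
    exact absurd h3 (not_le.2 (Real.rpow_lt_rpow hH.le hlt (by linarith)))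
  set Λ := 2 / C * ((2 - δ) * H ^ (δ - 1)) with hΛ
  have hΛ0 : 0 < Λ := by positivity
  have hF := hL.log_integral_exp_hopfLax_le hδ hδ2 hC hw hw0 hμ hφ hM hH hΛ
  have hQ := abs_hopfLax_le hM one_pos
  have hQm := (continuous_hopfLax hM one_pos).measurable
  have hei := integrable_exp_mul (μ := μ) hQm hQ hΛ0.le
  have hg2 : Integrable (fun x => g x ^ 2) μ := by
    refine .of_bound (by fun_prop) (B ^ 2) (Eventually.of_forall fun x => ?_)
    rw [norm_pow, Real.norm_eq_abs]
    gcongr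
    exact hB x
  obtain ⟨B', hB'⟩ := (isCompact_Icc (a := -B) (b := B)).exists_bound_of_continuousOn
    continuous_sq_mul_log_sq.continuousOn
  have hgl : Integrable (fun x => g x ^ 2 * Real.log (g x ^ 2)) μ :=
    .of_bound (by fun_prop) B' (Eventually.of_forall fun x => hB' _ (abs_le.1 (hB x)))
  have hgq : Integrable (fun x => g x ^ 2 * (Λ * hopfLax φ 1 x)) μ := by
    refine hg2.mul_bdd (c := Λ * M) (by fun_prop) (Eventually.of_forall fun x => ?_)
    rw [norm_mul, Real.norm_of_nonneg hΛ0.le]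
    exact mul_le_mul_of_nonneg_left (hQ x) hΛ0.le
  have hgibbs := integral_mul_le_entropy_add_log (fun x => sq_nonneg (g x)) hg2 hgl h1 hei hgq
    (integral_exp_pos hei)
  have h4 : ∫ x, g x ^ 2 * (Λ * hopfLax φ 1 x) ∂μ = Λ * ∫ x, g x ^ 2 * hopfLax φ 1 x ∂μ := by
    rw [← integral_const_mul]
    congr 1 with x
    ring
  rw [h4] at hgibbs
  have h5 : ∫ x, g x ^ 2 * hopfLax φ 1 x ∂μ ≤
      H / Λ + Real.log (∫ x, Real.exp (Λ * hopfLax φ 1 x) ∂μ) / Λ := by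
    rw [← add_div, le_div_iff₀ hΛ0]
    linarith
  have h6 : H / Λ + 2 / C * ((δ - 1) * H ^ δ) / Λ ^ 2 =
      C * H ^ (2 - δ) / (2 * (2 - δ) ^ 2) := by
    have e1 : H ^ δ = H ^ (δ - 1) * H := by
      rw [← Real.rpow_add_one hH.ne', sub_add_cancel]
    have e2 : H ^ (2 - δ) = H / H ^ (δ - 1) := by
      rw [show (2 - δ) = 1 - (δ - 1) by ring, Real.rpow_sub hH, Real.rpow_one]
    have hP : H ^ (δ - 1) ≠ 0 := (Real.rpow_pos_of_pos hH _).ne'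
    rw [hΛ, e1, e2]
    field_simp
    ring
  linarith

theorem PowerLogSobolev.dual_le_of_bounded (hL : PowerLogSobolev μ δ C)
    (hδ : 1 ≤ δ) (hδ2 : δ < 2) (hC : 0 < C) (hw : Continuous w) (hw0 : ∀ x, 0 < w x)
    (hμ : μ = m.withDensity fun x => ENNReal.ofReal (w x)) {g : E → ℝ} {G : E → E}
    (h : HasWeakGradient m g G) (hg : Measurable g) {B : ℝ}
    (hB : ∀ x, |g x| ≤ B) (hG : AEMeasurable G m) (h1 : ∫ x, g x ^ 2 ∂μ = 1) {J H : ℝ}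
    (hJ0 : 0 ≤ J) (hJ : ∫⁻ x, ‖G x‖ₑ ^ 2 ∂μ ≤ ENNReal.ofReal J) (hH : 0 < H)
    (hJH : C * J ≤ H ^ δ) {φ ψ : E → ℝ} (hφ : Measurable φ) (hψ : Measurable ψ) {M : ℝ}
    (hφM : ∀ x, |φ x| ≤ M) (hψM : ∀ x, |ψ x| ≤ M) (hφψ : ∀ x y, φ x + ψ y ≤ ‖x - y‖ ^ 2) :
    ∫ x, g x ^ 2 * φ x ∂μ + ∫ x, ψ x ∂μ ≤ C * H ^ (2 - δ) / (2 - δ) ^ 2 := by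
  have h2 : 2 - δ ≠ 0 := by linarith
  have hψ2 : ∀ x, |-ψ x / 2| ≤ M := fun x => by
    rw [abs_div, abs_neg, abs_two]
    linarith [hψM x, abs_nonneg (ψ x)]
  have key := hL.integral_hopfLax_mul_le hδ hδ2 hC hw hw0 hμ h hg hB hG h1 hJ0 hJ hH hJH
    (φ := fun x => -ψ x / 2) (by fun_prop) hψ2
  have hle : ∀ x, φ x / 2 ≤ hopfLax (fun x => -ψ x / 2) 1 x := fun x => by
    refine le_ciInf fun y => ?_
    have := hφψ x y
    linarith
  have hg2 : Integrable (fun x => g x ^ 2) μ := by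
    refine .of_bound (by fun_prop) (B ^ 2) (Eventually.of_forall fun x => ?_)
    rw [norm_pow, Real.norm_eq_abs]
    gcongr
    exact hB x
  have hQm := (continuous_hopfLax hψ2 one_pos).measurable
  have hmono : ∫ x, g x ^ 2 * (φ x / 2) ∂μ ≤
      ∫ x, g x ^ 2 * hopfLax (fun x => -ψ x / 2) 1 x ∂μ := by
    refine integral_mono (hg2.mul_bdd (c := M) (by fun_prop) (Eventually.of_forall fun x => ?_))
      (hg2.mul_bdd (c := M) (by fun_prop)
        (Eventually.of_forall (abs_hopfLax_le hψ2 one_pos)))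
      fun x => mul_le_mul_of_nonneg_left (hle x) (sq_nonneg _)
    rw [Real.norm_eq_abs, abs_div, abs_two]
    linarith [hφM x, abs_nonneg (φ x)]
  have e1 : ∫ x, g x ^ 2 * (φ x / 2) ∂μ = (∫ x, g x ^ 2 * φ x ∂μ) / 2 := by
    rw [← integral_div]
    congr 1 with x
    ring
  have e2 : ∫ x, -ψ x / 2 ∂μ = -(∫ x, ψ x ∂μ) / 2 := by
    rw [integral_div, integral_neg]
  have e3 : C * H ^ (2 - δ) / (2 - δ) ^ 2 = 2 * (C * H ^ (2 - δ) / (2 * (2 - δ) ^ 2)) := by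
    field_simp
  linarith

theorem hasDerivAt_mul_div_add {k x : ℝ} (hk : 0 < k) (hx : 0 ≤ x) :
    HasDerivAt (fun y => k * y / (k + y)) (k ^ 2 / (k + x) ^ 2) x := by
  refine ((((hasDerivAt_id x).const_mul k).div ((hasDerivAt_id x).const_add k)
    (by simp only [id]; positivity))).congr_deriv ?_
  simp only [id]
  ring

/-- The dual transport bound for a probability density `g²` with finite energy. -/
theorem PowerLogSobolev.dual_le (hL : PowerLogSobolev μ δ C)
    (hδ : 1 ≤ δ) (hδ2 : δ < 2) (hC : 0 < C) (hw : Continuous w) (hw0 : ∀ x, 0 < w x)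
    (hμ : μ = m.withDensity fun x => ENNReal.ofReal (w x)) {g : E → ℝ}
    (hg : Differentiable ℝ g) (hg0 : ∀ x, 0 ≤ g x) (hgi : Integrable (fun x => g x ^ 2) μ)
    (h1 : ∫ x, g x ^ 2 ∂μ = 1) {J H : ℝ}
    (hJ0 : 0 ≤ J) (hJ : ∫⁻ x, ‖gradient g x‖ₑ ^ 2 ∂μ ≤ ENNReal.ofReal J) (hH : 0 < H)
    (hJH : C * J < H ^ δ) {φ ψ : E → ℝ} (hφ : Measurable φ) (hψ : Measurable ψ) {M : ℝ}
    (hφM : ∀ x, |φ x| ≤ M) (hψM : ∀ x, |ψ x| ≤ M) (hφψ : ∀ x y, φ x + ψ y ≤ ‖x - y‖ ^ 2) :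
    ∫ x, g x ^ 2 * φ x ∂μ + ∫ x, ψ x ∂μ ≤ C * H ^ (2 - δ) / (2 - δ) ^ 2 := by
  have hk : ∀ k : ℕ, (0 : ℝ) < k + 1 := fun k => by positivity
  have hgm := hg.continuous.measurable
  set u : ℕ → E → ℝ := fun k x => (k + 1) * g x / ((k + 1) + g x) with hu
  have hum : ∀ k, Measurable (u k) := fun k => by fun_prop
  have hu0 : ∀ k x, 0 ≤ u k x := fun k x => by
    have := hg0 x; positivity
  have hug : ∀ k x, u k x ≤ g x := fun k x => by
    have := hg0 x
    rw [hu, div_le_iff₀ (by positivity)]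
    nlinarith
  have huk : ∀ k x, u k x ≤ k + 1 := fun k x => by
    have := hg0 x
    rw [hu, div_le_iff₀ (by positivity)]
    nlinarith [hk k]
  have hlim : ∀ x, Tendsto (fun k => u k x) atTop (𝓝 (g x)) := fun x => by
    have e1 : ∀ k : ℕ, u k x = g x / (1 + g x * ((k : ℝ) + 1)⁻¹) := fun k => by
      have := hg0 x
      have := hk k
      simp only [hu]
      field_simp
    have e2 : Tendsto (fun k : ℕ => ((k : ℝ) + 1)⁻¹) atTop (𝓝 0) := by
      simpa [one_div] using tendsto_one_div_add_atTop_nhds_zero_nat (𝕜 := ℝ)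
    have e3 : Tendsto (fun k : ℕ => g x / (1 + g x * ((k : ℝ) + 1)⁻¹)) atTop
        (𝓝 (g x / (1 + g x * 0))) :=
      tendsto_const_nhds.div ((e2.const_mul (g x)).const_add 1) (by simp)
    simpa [e1] using e3
  have hmul : ∀ ξ : E → ℝ, Measurable ξ → (∀ x, |ξ x| ≤ max M 1) →
      Tendsto (fun k => ∫ x, u k x ^ 2 * ξ x ∂μ) atTop (𝓝 (∫ x, g x ^ 2 * ξ x ∂μ)) := by
    intro ξ hξ hξM
    refine tendsto_integral_of_dominated_convergence (fun x => g x ^ 2 * max M 1)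
      (fun k => by fun_prop) (hgi.mul_const _) (fun k => Eventually.of_forall fun x => ?_)
      (Eventually.of_forall fun x => ((hlim x).pow 2).mul_const _)
    rw [norm_mul, Real.norm_of_nonneg (sq_nonneg _)]
    gcongr
    · exact hu0 k x
    · exact hug k x
    · exact hξM x
  have hN : Tendsto (fun k => ∫ x, u k x ^ 2 ∂μ) atTop (𝓝 1) := by
    have := hmul (fun _ => 1) measurable_const (fun x => by simp)
    simpa [h1] using this
  set N : ℕ → ℝ := fun k => ∫ x, u k x ^ 2 ∂μ with hNd
  have hφlim := hmul φ hφ fun x => (hφM x).trans (le_max_left _ _)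
  have hJlim : Tendsto (fun k => C * ((N k)⁻¹ * J)) atTop (𝓝 (C * (1⁻¹ * J))) :=
    ((hN.inv₀ one_ne_zero).mul_const J).const_mul C
  rw [inv_one, one_mul] at hJlim
  have hfin : Tendsto (fun k => (N k)⁻¹ * ∫ x, u k x ^ 2 * φ x ∂μ + ∫ x, ψ x ∂μ) atTop
      (𝓝 (1⁻¹ * ∫ x, g x ^ 2 * φ x ∂μ + ∫ x, ψ x ∂μ)) :=
    ((hN.inv₀ one_ne_zero).mul hφlim).add_const _
  rw [inv_one, one_mul] at hfin
  refine le_of_tendsto hfin ?_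
  filter_upwards [hN.eventually_const_lt one_pos, hJlim.eventually_le_const hJH] with k hNk hJk
  set c := (√(N k))⁻¹ with hc
  have hc0 : 0 ≤ c := by positivity
  have hc2 : c ^ 2 = (N k)⁻¹ := by rw [hc, inv_pow, Real.sq_sqrt hNk.le]
  have hder : ∀ x, HasFDerivAt (fun x => c * u k x)
      ((c * ((k + 1) ^ 2 / ((k + 1) + g x) ^ 2)) • fderiv ℝ g x) x := fun x => by
    have := ((hasDerivAt_mul_div_add (hk k) (hg0 x)).comp_hasFDerivAt x
      (hg x).hasFDerivAt).const_mul c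
    rwa [smul_smul] at this
  have hgrad : ∫⁻ x, ‖gradient (fun x => c * u k x) x‖ₑ ^ 2 ∂μ ≤
      ENNReal.ofReal ((N k)⁻¹ * J) := by
    rw [← hc2, ENNReal.ofReal_mul (sq_nonneg _)]
    refine le_trans ?_ (mul_le_mul_right hJ _)
    rw [← lintegral_const_mul' _ _ ENNReal.ofReal_ne_top]
    refine lintegral_mono fun x => ?_
    have := hg0 x
    have h3 : ((k : ℝ) + 1) ^ 2 / ((k + 1) + g x) ^ 2 ≤ 1 := by
      rw [div_le_one (by positivity)]
      exact pow_le_pow_left₀ (hk k).le (by linarith) 2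
    rw [enorm_gradient, enorm_gradient, (hder x).fderiv, enorm_smul, mul_pow, ← ofReal_norm,
      Real.norm_of_nonneg (by positivity), ENNReal.ofReal_pow hc0]
    gcongr
    exact mul_le_of_le_one_right hc0 h3
  have hv1 : ∫ x, (c * u k x) ^ 2 ∂μ = 1 := by
    simp only [mul_pow, integral_const_mul, hc2]
    exact inv_mul_cancel₀ hNk.ne'
  have hwg : HasWeakGradient m (fun x => c * u k x) (gradient fun x => c * u k x) :=
    hasWeakGradient_of_differentiable hw hw0 (fun x => (hder x).differentiableAt)
      (hμ ▸ (hgrad.trans_lt ENNReal.ofReal_lt_top).ne)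
  have hvB : ∀ x, |c * u k x| ≤ c * (k + 1) := fun x => by
    rw [abs_of_nonneg (mul_nonneg hc0 (hu0 k x))]
    exact mul_le_mul_of_nonneg_left (huk k x) hc0
  have key := hL.dual_le_of_bounded hδ hδ2 hC hw hw0 hμ hwg ((hum k).const_mul c) hvB
    (measurable_gradient _).aemeasurable hv1 (by positivity) hgrad hH hJk hφ hψ hφM hψM hφψ
  refine le_of_eq_of_le ?_ key
  congr 1
  rw [← integral_const_mul]
  refine integral_congr_ae (Eventually.of_forall fun x => ?_)
  simp only [mul_pow, hc2, mul_assoc]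

end TransportDual

section Wasserstein

open Filter Topology BoundedContinuousFunction

variable {n : ℕ} {μ ν : Measure (EuclideanSpace ℝ (Fin n))}

theorem wassersteinDist_two_sq_le [IsProbabilityMeasure ν] [IsProbabilityMeasure μ] {D : ℝ}
    (hD : ∀ φ ψ : EuclideanSpace ℝ (Fin n) →ᵇ ℝ, (∀ x y, φ x + ψ y ≤ ‖x - y‖ ^ 2) →
      ∫ x, φ x ∂ν + ∫ x, ψ x ∂μ ≤ D) :
    wassersteinDist 2 ν μ ^ 2 ≤ ENNReal.ofReal D := by
  obtain ⟨π, h1, h2, h3⟩ := exists_coupling_of_dual_le (ν := ν) (μ := μ)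
    (c := fun q => ‖q.1 - q.2‖ ^ 2) (by fun_prop) (fun q => sq_nonneg _) hD
  rw [wassersteinDist, ← ENNReal.rpow_natCast, ← ENNReal.rpow_mul]
  norm_num
  refine (iInf₂_le π ⟨h1, h2⟩).trans (le_of_eq_of_le (lintegral_congr fun q => ?_) h3)
  rw [edist_dist, dist_eq_norm, ENNReal.ofReal_pow (norm_nonneg _)]

variable [IsProbabilityMeasure μ] {δ C : ℝ} {w : EuclideanSpace ℝ (Fin n) → ℝ}

theorem PowerLogSobolev.wassersteinDist_sq_le_of_fisherInfo_lt (hL : PowerLogSobolev μ δ C)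
    (hδ : 1 ≤ δ) (hδ2 : δ < 2) (hC : 0 < C) (hw : Continuous w) (hw0 : ∀ x, 0 < w x)
    (hμ : μ = volume.withDensity fun x => ENNReal.ofReal (w x)) [IsProbabilityMeasure ν] {J : ℝ}
    (hJ : fisherInfo ν μ < ENNReal.ofReal J) :
    wassersteinDist 2 ν μ ^ 2 ≤
      ENNReal.ofReal (C ^ (2 / δ) / (2 - δ) ^ 2) * ENNReal.ofReal J ^ ((2 - δ) / δ) := by
  have hJ0 : 0 < J := ENNReal.ofReal_pos.1 (bot_le.trans_lt hJ)
  have hδ0 : 0 < δ := by linarith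
  have h2 : 0 < 2 - δ := by linarith
  simp only [fisherInfo, iInf_lt_iff] at hJ
  obtain ⟨f, hf0, hf, hd, hI⟩ := hJ
  have hfm : Measurable f := by
    have : Measurable fun x => √(f x) ^ 2 := hd.continuous.measurable.pow_const 2
    simpa only [Real.sq_sqrt (hf0 _)] using this
  have hone : ∫⁻ x, ENNReal.ofReal (f x) ∂μ = 1 := by
    rw [← setLIntegral_univ, ← withDensity_apply _ MeasurableSet.univ, ← hf, measure_univ]
  have hfi : Integrable f μ := by
    refine ⟨hfm.aestronglyMeasurable, ?_⟩
    rw [hasFiniteIntegral_iff_ofReal (Eventually.of_forall hf0), hone]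
    exact ENNReal.one_lt_top
  have hint : ∫ x, f x ∂μ = 1 := by
    rw [integral_eq_lintegral_of_nonneg_ae (Eventually.of_forall hf0) hfm.aestronglyMeasurable,
      hone, ENNReal.toReal_one]
  set H := (C * J) ^ (1 / δ) with hH
  have hD : C * H ^ (2 - δ) / (2 - δ) ^ 2 =
      C ^ (2 / δ) / (2 - δ) ^ 2 * J ^ ((2 - δ) / δ) := by
    have e : (2 / δ : ℝ) = 1 + (2 - δ) / δ := by field_simp; ring
    rw [hH, ← Real.rpow_mul (by positivity), one_div_mul_eq_div, Real.mul_rpow hC.le hJ0.le, e,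
      Real.rpow_add hC, Real.rpow_one]
    ring
  rw [ENNReal.ofReal_rpow_of_pos hJ0, ← ENNReal.ofReal_mul (by positivity), ← hD]
  refine wassersteinDist_two_sq_le fun φ ψ hφψ => ?_
  have hφ : ∫ x, φ x ∂ν = ∫ x, √(f x) ^ 2 * φ x ∂μ := by
    rw [hf, integral_withDensity_eq_integral_toReal_smul (by fun_prop)
      (Eventually.of_forall fun x => ENNReal.ofReal_lt_top)]
    simp only [Real.sq_sqrt (hf0 _), ENNReal.toReal_ofReal (hf0 _), smul_eq_mul]
  rw [hφ]
  refine hL.dual_le hδ hδ2 hC hw hw0 hμ hd (fun x => Real.sqrt_nonneg _)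
    (by simpa only [Real.sq_sqrt (hf0 _)] using hfi)
    (by simpa only [Real.sq_sqrt (hf0 _)] using hint) ENNReal.toReal_nonneg
    (ENNReal.ofReal_toReal hI.ne_top).ge (by positivity) ?_
    φ.continuous.measurable ψ.continuous.measurable
    (fun x => (φ.norm_coe_le_norm x).trans (le_max_left ‖φ‖ ‖ψ‖))
    (fun x => (ψ.norm_coe_le_norm x).trans (le_max_right ‖φ‖ ‖ψ‖)) hφψ
  rw [hH, ← Real.rpow_mul (by positivity), one_div_mul_cancel hδ0.ne', Real.rpow_one]
  exact mul_lt_mul_of_pos_left (ENNReal.toReal_lt_of_lt_ofReal hI) hC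

theorem ENNReal.le_mul_rpow_of_forall_lt {a b t : ℝ≥0∞} {p : ℝ} (hb0 : b ≠ 0) (hb : b ≠ ⊤)
    (hp : 0 < p) (h : ∀ J : ℝ, t < ENNReal.ofReal J → a ≤ b * ENNReal.ofReal J ^ p) :
    a ≤ b * t ^ p := by
  rcases eq_or_ne t ⊤ with rfl | ht
  · simp [ENNReal.top_rpow_of_pos hp, ENNReal.mul_top hb0]
  · have hlim : Tendsto (fun J : ℝ => b * ENNReal.ofReal J ^ p) (𝓝[>] t.toReal)
        (𝓝 (b * ENNReal.ofReal t.toReal ^ p)) :=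
      ((ENNReal.continuous_const_mul hb).comp
        (ENNReal.continuous_rpow_const.comp ENNReal.continuous_ofReal)).continuousAt.mono_left
        nhdsWithin_le_nhds
    rw [ENNReal.ofReal_toReal ht] at hlim
    refine ge_of_tendsto hlim ?_
    filter_upwards [self_mem_nhdsWithin] with J hJ
    exact h J ((ENNReal.lt_ofReal_iff_toReal_lt ht).2 hJ)

end Wasserstein

/-- **Corollary 4.2, direct part**: for `δ ∈ [1,2)`, the inequality
`μ(g² log g²)^δ ≤ C μ(|∇g|²)` implies
`W₂(ν,μ)² ≤ (C^{2/δ}/(2−δ)²) I(ν|μ)^{(2−δ)/δ}`. -/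
theorem power_logSobolev_implies_W2I {n : ℕ}
    (V : EuclideanSpace ℝ (Fin n) → ℝ) (hV : Continuous V) (Z : ℝ) (hZ : 0 < Z)
    (μ : Measure (EuclideanSpace ℝ (Fin n)))
    (hμ : μ = volume.withDensity fun x => ENNReal.ofReal (Real.exp (-V x) / Z))
    (hμprob : IsProbabilityMeasure μ)
    (δ : ℝ) (hδ₁ : 1 ≤ δ) (hδ₂ : δ < 2) (C : ℝ) (hC : 0 < C)
    (hLSI : ∀ g : EuclideanSpace ℝ (Fin n) → ℝ, ContDiff ℝ 1 g →
      (∃ M, ∀ x, |g x| ≤ M) → (∫ x, g x ^ 2 ∂μ) = 1 →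
      ENNReal.ofReal ((∫ x, g x ^ 2 * Real.log (g x ^ 2) ∂μ) ^ δ) ≤
        ENNReal.ofReal C * ∫⁻ x, (‖gradient g x‖₊ : ℝ≥0∞) ^ 2 ∂μ) :
    ∀ ν : Measure (EuclideanSpace ℝ (Fin n)), IsProbabilityMeasure ν →
      wassersteinDist 2 ν μ ^ 2 ≤
        ENNReal.ofReal (C ^ (2 / δ) / (2 - δ) ^ 2) *
          fisherInfo ν μ ^ ((2 - δ) / δ) := by
  intro ν hν
  have h2 : 0 < 2 - δ := by linarith
  have hL : PowerLogSobolev μ δ C := fun g hg hM h1 => by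
    simp only [← enorm_gradient]
    exact hLSI g hg hM h1
  refine ENNReal.le_mul_rpow_of_forall_lt (ENNReal.ofReal_pos.2 (by positivity)).ne'
    ENNReal.ofReal_ne_top (by positivity) fun J hJ => ?_
  exact hL.wassersteinDist_sq_le_of_fisherInfo_lt hδ₁ hδ₂ hC (by fun_prop (disch := positivity))
    (fun x => by positivity) hμ hJ
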